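/- arXiv:1207.5126 — 2 statements merged into one kernel-verified Lean document; each statement's English description precedes it below -/
import Mathlib

section
/- Let μ be a positive Borel measure on ℝ and let 𝓛 be an algebraic de Branges space such that ∫_ℝ |F| dμ < ∞ for all F ∈ 𝓛, and such that F ∈ 𝓛 with ∫_ℝ |F| dμ = 0 implies F = 0. Assume 𝓛 (via restriction to ℝ) is not dense in L¹(μ), and let 𝔪(z) := sup{|F(z)| : F ∈ 𝓛, ‖F|_ℝ‖_{L¹(μ)} ≤ 1}. Then every element f of the closure of 𝓛 in L¹(μ) equals μ-almost everywhere the restriction to ℝ of an entire function F satisfying |F(z)| ≤ 𝔪(z)·‖f‖_{L¹(μ)} for all z ∈ ℂ. -/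
open Filter MeasureTheory
open scoped ENNReal NNReal

/-- An algebraic de Branges space: a linear space of entire functions, invariant
under division of zeros and under `F ↦ F^#`. -/
def IsAlgebraicDeBranges (L : Submodule ℂ (ℂ → ℂ)) : Prop :=
  (∀ F ∈ L, Differentiable ℂ F) ∧
  (∀ F ∈ L, ∀ w : ℂ, F w = 0 → ∃ G ∈ L, ∀ z : ℂ, z ≠ w → G z = F z / (z - w)) ∧
  (∀ F ∈ L, (fun z => (starRingEnd ℂ) (F ((starRingEnd ℂ) z))) ∈ L)

/-- The norm of the point evaluation at `z`:
`𝔪(z) = sup {|F(z)| : F ∈ 𝓛, ‖F|_ℝ‖_{L¹(μ)} ≤ 1}`, with value `∞` if unbounded. -/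
noncomputable def L1Majorant (μ : Measure ℝ) (L : Submodule ℂ (ℂ → ℂ)) (z : ℂ) : ℝ≥0∞ :=
  ⨆ F : {F : ℂ → ℂ // F ∈ L ∧ (∫⁻ x : ℝ, (‖F (x : ℂ)‖₊ : ℝ≥0∞) ∂μ) ≤ 1},
    (‖F.1 z‖₊ : ℝ≥0∞)

/-- `f` belongs to the closure of (the restrictions of) `L` in `L¹(μ)`. -/
def MemClosL1 (μ : Measure ℝ) (L : Submodule ℂ (ℂ → ℂ)) (f : ℝ → ℂ) : Prop :=
  Integrable f μ ∧ ∀ ε : ℝ, 0 < ε →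
    ∃ F ∈ L, (∫⁻ x : ℝ, (‖f x - F (x : ℂ)‖₊ : ℝ≥0∞) ∂μ) < ENNReal.ofReal ε

/-- Density of (the restrictions to `ℝ` of) `L` in `L¹(μ)`. -/
def DenseL1 (μ : Measure ℝ) (L : Submodule ℂ (ℂ → ℂ)) : Prop :=
  ∀ f : ℝ → ℂ, Integrable f μ → MemClosL1 μ L f

section HalfPlane

open Metric Real

theorem log_norm_le_circleAverage {f : ℂ → ℂ} {c : ℂ} {R : ℝ} (hR : 0 < R)
    (hf : AnalyticOnNhd ℂ f (closedBall c R)) (hc : f c ≠ 0) :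
    log ‖f c‖ ≤ circleAverage (fun z => log ‖f z‖) c R := by
  have hR' : |R| = R := abs_of_pos hR
  have hf' : AnalyticOnNhd ℂ f (closedBall c |R|) := by rwa [hR']
  have h := hf'.circleAverage_log_norm hR.ne' hc
  rw [h]
  refine le_add_of_nonneg_left (finsum_nonneg fun u => ?_)
  by_cases hu : u ∈ closedBall c |R|
  · refine mul_nonneg (by
      exact_mod_cast MeromorphicOn.AnalyticOnNhd.divisor_nonneg hf' u) ?_
    rcases eq_or_ne c u with rfl | hcu
    · simp
    · apply log_nonneg
      rw [mem_closedBall, dist_comm, dist_eq_norm, hR'] at hu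
      rw [← div_eq_mul_inv, one_le_div (norm_pos_iff.2 (sub_ne_zero.2 hcu))]
      exact hu
  · simp [hu]

theorem posLog_norm_le_circleAverage {f : ℂ → ℂ} {c : ℂ} {R : ℝ} (hR : 0 < R)
    (hf : AnalyticOnNhd ℂ f (closedBall c R)) :
    log⁺ ‖f c‖ ≤ circleAverage (fun z => log⁺ ‖f z‖) c R := by
  have hR' : |R| = R := abs_of_pos hR
  have hm : MeromorphicOn f (sphere c |R|) := by
    rw [hR']; exact (hf.mono sphere_subset_closedBall).meromorphicOn
  have h0 : 0 ≤ circleAverage (fun z => log⁺ ‖f z‖) c R :=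
    circleAverage_nonneg_of_nonneg fun _ _ => posLog_nonneg
  by_cases hc : f c = 0
  · simpa [hc] using h0
  refine max_le h0 ((log_norm_le_circleAverage hR hf hc).trans ?_)
  exact circleAverage_mono hm.circleIntegrable_log_norm hm.circleIntegrable_posLog_norm
    fun z _ => le_max_right _ _

theorem lintegral_ball_eq_lintegral_circleMap {g : ℂ → ℝ≥0∞} (c : ℂ) (R : ℝ) (hg : Measurable g) :
    ∫⁻ z in ball c R, g z = ∫⁻ r in Set.Ioo 0 R, ENNReal.ofReal r *
      ∫⁻ θ in Set.Ioo (-π) π, g (circleMap c r θ) := by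
  have h1 : ∫⁻ z in ball c R, g z = ∫⁻ z, (ball (0:ℂ) R).indicator (fun z => g (c + z)) z := by
    rw [← lintegral_indicator measurableSet_ball, ← lintegral_add_left_eq_self _ c]
    congr 1 with z
    simp [Set.indicator]
  rw [h1, ← Complex.lintegral_comp_polarCoord_symm, polarCoord_target, Measure.volume_eq_prod,
    ← Measure.prod_restrict, lintegral_prod]
  · rw [← lintegral_indicator measurableSet_Ioi, ← lintegral_indicator measurableSet_Ioo]
    congr 1 with r
    by_cases hr : 0 < r
    · by_cases hrR : r < R
      · simp only [Set.indicator, Set.mem_Ioi, hr, Set.mem_Ioo, hrR, and_self, if_true]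
        rw [← lintegral_const_mul _ (by fun_prop)]
        congr 1 with θ
        simp [hrR, abs_of_pos hr, circleMap, Complex.exp_mul_I]
      · simp [Set.indicator, hr, hrR, abs_of_pos hr]
    · simp [Set.indicator, hr]
  · refine Measurable.aemeasurable ?_
    have : Measurable ((ball (0:ℂ) R).indicator (fun z => g (c + z))) :=
      (by fun_prop : Measurable fun z => g (c + z)).indicator measurableSet_ball
    have h2 : Measurable Complex.polarCoord.symm := by
      have : (Complex.polarCoord.symm : ℝ × ℝ → ℂ) = fun p => (p.1 : ℂ) * (cos p.2 + sin p.2 * Complex.I) := by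
        ext p; simp
      rw [this]; fun_prop
    exact (by fun_prop : Measurable fun p : ℝ × ℝ => ENNReal.ofReal p.1).smul (this.comp h2)

theorem lintegral_circleMap_eq_circleAverage {g : ℂ → ℝ} {c : ℂ} {r : ℝ}
    (hg : CircleIntegrable g c r) (h0 : ∀ z, 0 ≤ g z) :
    ∫⁻ θ in Set.Ioo (-π) π, ENNReal.ofReal (g (circleMap c r θ)) =
      ENNReal.ofReal (2 * π * circleAverage g c r) := by
  have hpi : (-π) ≤ π := by linarith [pi_pos]
  have hper : Function.Periodic (fun θ => g (circleMap c r θ)) (2 * π) :=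
    (periodic_circleMap c r).comp g
  have hint : IntervalIntegrable (fun θ => g (circleMap c r θ)) volume (-π) π := by
    have := hper.intervalIntegrable two_pi_pos.ne' (t := 0) (by rw [zero_add]; exact hg) (-π) π
    exact this
  rw [circleAverage_eq_integral_add (-π), intervalIntegral.integral_comp_add_right (fun θ => g (circleMap c r θ))]
  rw [show (0:ℝ) + -π = -π by ring, show 2 * π + -π = π by ring, intervalIntegral.integral_of_le hpi,
    integral_Ioc_eq_integral_Ioo, smul_eq_mul, mul_inv_cancel_left₀ two_pi_pos.ne',
    ofReal_integral_eq_lintegral_ofReal]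
  · exact ((intervalIntegrable_iff_integrableOn_Ioo_of_le hpi).1 hint)
  · exact ae_of_all _ fun _ => h0 _

theorem lintegral_ball_posLog_inv_lt_top {h : ℂ → ℂ} (hd : DifferentiableOn ℂ h (ball 0 1))
    (h0 : h 0 ≠ 0) {K : ℝ} (hK : ∀ z ∈ ball (0 : ℂ) 1, ‖h z‖ ≤ K / (1 - ‖z‖)) (M : ℝ) :
    ∫⁻ z in ball (0 : ℂ) 1, ENNReal.ofReal (log⁺ (M / (1 - ‖z‖)) + log⁺ ‖h z‖⁻¹) < ⊤ := by
  set u : ℂ → ℝ := fun z => log⁺ (M / (1 - ‖z‖)) + log⁺ ‖h z‖⁻¹ with hu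
  set g : ℂ → ℝ≥0∞ := (ball (0 : ℂ) 1).indicator fun z => ENNReal.ofReal (u z) with hg
  have hgm : Measurable g := by
    have h1 : Measurable ((ball (0 : ℂ) 1).indicator h) := by
      classical
      rw [← Set.piecewise_eq_indicator]
      exact hd.continuousOn.measurable_piecewise continuousOn_const measurableSet_ball
    have h2 : g = (ball (0 : ℂ) 1).indicator fun z => ENNReal.ofReal
        (log⁺ (M / (1 - ‖z‖)) + log⁺ ‖(ball (0 : ℂ) 1).indicator h z‖⁻¹) := by
      ext z
      by_cases hz : z ∈ ball (0 : ℂ) 1 <;> simp only [hg, hu, Set.indicator, hz, if_true, if_false]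
    rw [h2]
    have h3 : Measurable log⁺ := continuous_posLog.measurable
    exact (by fun_prop : Measurable fun z => ENNReal.ofReal
        (log⁺ (M / (1 - ‖z‖)) + log⁺ ‖(ball (0 : ℂ) 1).indicator h z‖⁻¹)).indicator measurableSet_ball
  have e1 : ∫⁻ z in ball (0 : ℂ) 1, ENNReal.ofReal (u z) = ∫⁻ z in ball (0 : ℂ) 1, g z := by
    refine setLIntegral_congr_fun measurableSet_ball fun z hz => ?_
    simp only [hg, Set.indicator, hz, if_true]
  rw [e1, lintegral_ball_eq_lintegral_circleMap 0 1 hgm]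
  set A : ℝ := log⁺ M + log⁺ K + |log ‖h 0‖| with hA
  have key : ∀ r ∈ Set.Ioo (0 : ℝ) 1, ENNReal.ofReal r *
      ∫⁻ θ in Set.Ioo (-π) π, g (circleMap 0 r θ) ≤
        ENNReal.ofReal (2 * π * (A + 2 * -log (1 - r))) := by
    intro r hr
    have hr' : |r| = r := abs_of_pos hr.1
    have hsub : closedBall (0 : ℂ) r ⊆ ball 0 1 := closedBall_subset_ball hr.2
    have han : AnalyticOnNhd ℂ h (closedBall 0 r) := (hd.analyticOnNhd isOpen_ball).mono hsub
    have hm : MeromorphicOn h (sphere 0 |r|) := by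
      rw [hr']; exact (han.mono sphere_subset_closedBall).meromorphicOn
    have hmi : MeromorphicOn h⁻¹ (sphere 0 |r|) := hm.inv
    have hi1 : CircleIntegrable (fun z => log⁺ ‖h z‖⁻¹) 0 r := by
      simpa using hmi.circleIntegrable_posLog_norm
    have hi2 : CircleIntegrable (fun z => log⁺ ‖h z‖) 0 r := hm.circleIntegrable_posLog_norm
    have h1r : 0 < 1 - r := by linarith [hr.2]
    have hlog : ∀ B : ℝ, log⁺ (B / (1 - r)) ≤ log⁺ B + -log (1 - r) := fun B => by
      rw [div_eq_mul_inv]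
      refine posLog_mul.trans_eq ?_
      rw [posLog_eq_log (x := (1 - r)⁻¹), log_inv]
      rw [abs_of_pos (by positivity)]
      exact (one_le_inv₀ h1r).2 (by linarith [hr.1])
    have hs : ∀ z ∈ sphere (0 : ℂ) |r|, ‖z‖ = r := fun z hz => by simpa [hr'] using hz
    have hav : circleAverage (fun z => log⁺ ‖h z‖⁻¹) 0 r ≤ log⁺ K + -log (1 - r) - log ‖h 0‖ := by
      have h3 : circleAverage (fun z => log ‖h z‖) 0 r =
          circleAverage (fun z => log⁺ ‖h z‖) 0 r - circleAverage (fun z => log⁺ ‖h z‖⁻¹) 0 r := by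
        rw [← circleAverage_fun_sub hi2 hi1]
        simp_rw [posLog_sub_posLog_inv]
      have h4 := log_norm_le_circleAverage hr.1 han h0
      have h5 : circleAverage (fun z => log⁺ ‖h z‖) 0 r ≤ log⁺ (K / (1 - r)) := by
        refine circleAverage_mono_on_of_le_circle hi2 fun z hz => ?_
        have hz' := hs z hz
        have := hK z (by simp [hz', hr.2])
        rw [hz'] at this
        exact posLog_le_posLog (norm_nonneg _) this
      linarith [hlog K]
    set v : ℂ → ℝ := fun z => log⁺ (M / (1 - r)) + log⁺ ‖h z‖⁻¹ with hv
    have hvi : CircleIntegrable v 0 r := (circleIntegrable_const _ _ _).add hi1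
    have e2 : ∫⁻ θ in Set.Ioo (-π) π, g (circleMap 0 r θ) =
        ENNReal.ofReal (2 * π * circleAverage v 0 r) := by
      rw [← lintegral_circleMap_eq_circleAverage hvi fun z => add_nonneg posLog_nonneg posLog_nonneg]
      congr 1 with θ
      have : circleMap 0 r θ ∈ ball (0 : ℂ) 1 := by simp [hr', hr.2]
      simp only [hg, Set.indicator, this, if_true, hu, hv]
      simp [hr']
    rw [e2]
    refine (mul_le_of_le_one_left zero_le (ENNReal.ofReal_le_one.2 hr.2.le)).trans ?_
    refine ENNReal.ofReal_le_ofReal (mul_le_mul_of_nonneg_left ?_ two_pi_pos.le)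
    rw [hv, circleAverage_fun_add (circleIntegrable_const _ _ _) hi1, circleAverage_const]
    linarith [hlog M, neg_abs_le (log ‖h 0‖)]
  refine (setLIntegral_mono' measurableSet_Ioo key).trans_lt ?_
  have hint : IntegrableOn (fun r : ℝ => 2 * π * (A + 2 * -log (1 - r))) (Set.Ioo 0 1) := by
    rw [← intervalIntegrable_iff_integrableOn_Ioo_of_le zero_le_one]
    have : IntervalIntegrable (fun r : ℝ => log (1 - r)) volume 0 1 := by
      have := (intervalIntegral.intervalIntegrable_log' (a := 1) (b := 0)).comp_sub_left 1
      simpa using this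
    exact (intervalIntegrable_const.add (this.neg.const_mul 2)).const_mul _
  exact hint.lintegral_lt_top

theorem abs_det_smul_one (a : ℂ) :
    |(a • (1 : ℂ →L[ℝ] ℂ)).det| = ‖a‖ ^ 2 := by
  have : (a • (1 : ℂ →L[ℝ] ℂ)).det = Algebra.norm ℝ a := by
    rw [Algebra.norm_apply]
    rfl
  rw [this, Algebra.norm_complex_apply, Complex.normSq_eq_norm_sq, abs_of_nonneg (by positivity)]

theorem lintegral_halfPlane_posLog_inv_lt_top {N : ℂ → ℂ} {c : ℂ} (hc : c.im ≠ 0)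
    (hd : DifferentiableOn ℂ N {w | 0 < w.im * c.im}) (hNc : N c ≠ 0) {K : ℝ} (hK0 : 0 ≤ K)
    (hK : ∀ w ∈ {w : ℂ | 0 < w.im * c.im}, ‖N w‖ ≤ K / |w.im|) {M : ℝ} (hM : 0 ≤ M) (R : ℝ) :
    ∫⁻ w in ball (0 : ℂ) R ∩ {w | 0 < w.im * c.im},
      ENNReal.ofReal (log⁺ (M / |w.im|) + log⁺ ‖N w‖⁻¹) < ⊤ := by
  set U : Set ℂ := {w | 0 < w.im * c.im} with hU
  set u : ℂ → ℝ≥0∞ := fun w => ENNReal.ofReal (log⁺ (M / |w.im|) + log⁺ ‖N w‖⁻¹) with hu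
  set cb : ℂ := (starRingEnd ℂ) c with hcb
  have hcb_im : cb.im = -c.im := by simp [hcb]
  have hcb_re : cb.re = c.re := by simp [hcb]
  have hcc : c - cb ≠ 0 := fun h => hc (by
    have := congrArg Complex.im h
    simp [hcb_im] at this
    exact this)
  have hden : ∀ w ∈ U, w - cb ≠ 0 := fun w hw h => by
    have h2 := congrArg Complex.im h
    simp only [Complex.sub_im, hcb_im, Complex.zero_im] at h2
    have : w.im = -c.im := by linarith
    simp only [hU, Set.mem_ofPred_eq, this] at hw
    nlinarith [sq_nonneg c.im]
  set ψ : ℂ → ℂ := fun w => (w - c) / (w - cb) with hψ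
  set φ : ℂ → ℂ := fun z => (c - cb * z) / (1 - z) with hφ
  have hφψ : ∀ w ∈ U, φ (ψ w) = w := fun w hw => by
    have h1 := hden w hw
    have h2 : 1 - (w - c) / (w - cb) = (c - cb) / (w - cb) := by field_simp; ring
    simp only [hφ, hψ, h2]
    field_simp
    ring
  have hz1 : ∀ z ∈ ball (0 : ℂ) 1, 1 - z ≠ 0 := fun z hz h => by
    have : z = 1 := (sub_eq_zero.1 h).symm
    simp [this] at hz
  have hφim : ∀ z ∈ ball (0 : ℂ) 1, (φ z).im = c.im * ((1 - ‖z‖ ^ 2) / ‖1 - z‖ ^ 2) := by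
    intro z hz
    have h1 : Complex.normSq (1 - z) ≠ 0 := by simpa using hz1 z hz
    have h2 : ‖1 - z‖ ^ 2 = Complex.normSq (1 - z) := (Complex.normSq_eq_norm_sq _).symm
    have h3 : ‖z‖ ^ 2 = Complex.normSq z := (Complex.normSq_eq_norm_sq _).symm
    rw [h2, h3]
    simp only [hφ, Complex.div_im]
    field_simp
    simp [Complex.normSq_apply, hcb]
    ring
  have hφlow : ∀ z ∈ ball (0 : ℂ) 1, (1 - ‖z‖) / 2 ≤ (1 - ‖z‖ ^ 2) / ‖1 - z‖ ^ 2 := by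
    intro z hz
    have hz' : ‖z‖ < 1 := by simpa using hz
    have h1 : 0 < ‖1 - z‖ := norm_pos_iff.2 (hz1 z hz)
    have h2 : ‖1 - z‖ ≤ 1 + ‖z‖ := by simpa using norm_sub_le (1 : ℂ) z
    have h0 := norm_nonneg z
    rw [div_le_div_iff₀ two_pos (by positivity)]
    have h3 : ‖1 - z‖ ^ 2 ≤ (1 + ‖z‖) ^ 2 := pow_le_pow_left₀ h1.le h2 2
    calc (1 - ‖z‖) * ‖1 - z‖ ^ 2 ≤ (1 - ‖z‖) * (1 + ‖z‖) ^ 2 := by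
          apply mul_le_mul_of_nonneg_left h3; linarith
      _ = (1 - ‖z‖ ^ 2) * (1 + ‖z‖) := by ring
      _ ≤ (1 - ‖z‖ ^ 2) * 2 := by
          apply mul_le_mul_of_nonneg_left <;> nlinarith
  have hφabs : ∀ z ∈ ball (0 : ℂ) 1, |c.im| * ((1 - ‖z‖) / 2) ≤ |(φ z).im| := by
    intro z hz
    have hz' : ‖z‖ < 1 := by simpa using hz
    rw [hφim z hz, abs_mul]
    exact mul_le_mul_of_nonneg_left ((hφlow z hz).trans (le_abs_self _)) (abs_nonneg _)
  have hφU : Set.MapsTo φ (ball 0 1) U := by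
    intro z hz
    have hz' : ‖z‖ < 1 := by simpa using hz
    simp only [hU, Set.mem_ofPred_eq, hφim z hz]
    have := hφlow z hz
    have h3 : 0 < (1 - ‖z‖ ^ 2) / ‖1 - z‖ ^ 2 := by linarith
    have : 0 < c.im * c.im := mul_self_pos.2 hc
    nlinarith
  have hφd : DifferentiableOn ℂ φ (ball 0 1) := by
    intro z hz
    have := hz1 z hz
    exact DifferentiableAt.differentiableWithinAt (by fun_prop (disch := assumption))
  have hc' : 0 < |c.im| := abs_pos.2 hc
  have hbd : ∀ B : ℝ, 0 ≤ B → ∀ z ∈ ball (0 : ℂ) 1, B / |(φ z).im| ≤ (2 * B / |c.im|) / (1 - ‖z‖) := by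
    intro B hB z hz
    have hz' : 0 < 1 - ‖z‖ := by simpa using hz
    have h1 := hφabs z hz
    calc B / |(φ z).im| ≤ B / (|c.im| * ((1 - ‖z‖) / 2)) := by gcongr
      _ = _ := by field_simp
  have hfin := lintegral_ball_posLog_inv_lt_top (h := N ∘ φ) (hd.comp hφd hφU)
    (by simpa [hφ] using hNc) (K := 2 * K / |c.im|)
    (fun z hz => (hK _ (hφU hz)).trans (hbd K hK0 z hz)) (2 * M / |c.im|)
  have hψU : Set.MapsTo ψ U (ball 0 1) := by
    intro w hw
    have h1 : 0 < ‖w - cb‖ := norm_pos_iff.2 (hden w hw)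
    simp only [hψ, mem_ball_zero_iff, norm_div]
    rw [div_lt_one h1, ← sq_lt_sq₀ (norm_nonneg _) h1.le, ← Complex.normSq_eq_norm_sq,
      ← Complex.normSq_eq_norm_sq, Complex.normSq_apply, Complex.normSq_apply]
    simp only [Complex.sub_re, Complex.sub_im, hcb_re, hcb_im]
    simp only [hU, Set.mem_ofPred_eq] at hw
    nlinarith
  set s := ball (0 : ℂ) R ∩ U with hs
  have hUm : MeasurableSet U := by
    exact measurableSet_lt measurable_const (Complex.measurable_im.mul_const _)
  have hsm : MeasurableSet s := measurableSet_ball.inter hUm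
  have hder : ∀ w ∈ s, HasFDerivWithinAt ψ (((c - cb) / (w - cb) ^ 2) • (1 : ℂ →L[ℝ] ℂ)) s w := by
    intro w hw
    have h1 := hden w hw.2
    have : HasDerivAt ψ ((c - cb) / (w - cb) ^ 2) w := by
      refine (((hasDerivAt_id w).sub_const c).div ((hasDerivAt_id w).sub_const cb) h1).congr_deriv ?_
      simp only [id]
      ring
    exact this.complexToReal_fderiv.hasFDerivWithinAt
  have hinj : Set.InjOn ψ s := fun a ha b hb hab => by
    rw [← hφψ a ha.2, ← hφψ b hb.2, hab]
  have hcov := lintegral_image_eq_lintegral_abs_det_fderiv_mul volume hsm hder hinj (u ∘ φ)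
  have hle : ∫⁻ z in ψ '' s, (u ∘ φ) z < ⊤ := by
    have hsub : ψ '' s ⊆ ball 0 1 := Set.image_subset_iff.2 fun w hw => hψU hw.2
    refine ((lintegral_mono_set hsub).trans ?_).trans_lt hfin
    refine setLIntegral_mono' measurableSet_ball fun z hz => ?_
    refine ENNReal.ofReal_le_ofReal (add_le_add ?_ le_rfl)
    exact posLog_le_posLog (by positivity) (hbd M hM z hz)
  rw [hcov] at hle
  rcases s.eq_empty_or_nonempty with he | ⟨w0, hw0⟩
  · simp [he]
  have hR : 0 < R := by
    have h := hw0.1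
    rw [mem_ball_zero_iff] at h
    exact (norm_nonneg _).trans_lt h
  set δ : ℝ := (‖c - cb‖ / (R + ‖c‖) ^ 2) ^ 2 with hδ
  have hδ0 : 0 < δ := by
    have : 0 < ‖c - cb‖ := norm_pos_iff.2 hcc
    positivity
  have hfinal : ENNReal.ofReal δ * ∫⁻ w in s, u w < ⊤ := by
    rw [← lintegral_const_mul' _ _ ENNReal.ofReal_ne_top]
    refine (setLIntegral_mono' hsm fun w hw => ?_).trans_lt hle
    rw [Function.comp_apply, hφψ w hw.2, abs_det_smul_one]
    refine mul_le_mul_left (ENNReal.ofReal_le_ofReal ?_) _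
    have h1 : 0 < ‖w - cb‖ := norm_pos_iff.2 (hden w hw.2)
    have h2 : ‖w - cb‖ ≤ R + ‖c‖ := by
      refine (norm_sub_le _ _).trans (add_le_add ?_ ?_)
      · exact (mem_ball_zero_iff.1 hw.1).le
      · simp [hcb]
    rw [norm_div, norm_pow, hδ]
    gcongr
  exact lt_top_iff_ne_top.2 fun h => by
    rw [h, ENNReal.mul_top (by simpa using hδ0)] at hfinal
    exact lt_irrefl _ hfinal

theorem ofReal_posLog_norm_le_lintegral_ball {F : ℂ → ℂ} (hF : Differentiable ℂ F) (z : ℂ) :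
    ENNReal.ofReal (π / 2 * log⁺ ‖F z‖) ≤ ∫⁻ w in ball z 1, ENNReal.ofReal (log⁺ ‖F w‖) := by
  have hm : Measurable fun w => ENNReal.ofReal (log⁺ ‖F w‖) :=
    ENNReal.measurable_ofReal.comp (continuous_posLog.comp hF.continuous.norm).measurable
  rw [lintegral_ball_eq_lintegral_circleMap z 1 hm]
  have hsub : Set.Ioo (1 / 2 : ℝ) 1 ⊆ Set.Ioo 0 1 := Set.Ioo_subset_Ioo_left (by norm_num)
  refine le_trans ?_ (lintegral_mono_set hsub)
  have key : ∀ r ∈ Set.Ioo (1 / 2 : ℝ) 1, ENNReal.ofReal (π * log⁺ ‖F z‖) ≤ ENNReal.ofReal r *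
      ∫⁻ θ in Set.Ioo (-π) π, ENNReal.ofReal (log⁺ ‖F (circleMap z r θ)‖) := by
    intro r hr
    have hr0 : 0 < r := by linarith [hr.1]
    have han : AnalyticOnNhd ℂ F Set.univ := hF.differentiableOn.analyticOnNhd isOpen_univ
    have hi : CircleIntegrable (fun w => log⁺ ‖F w‖) z r :=
      (continuous_posLog.comp hF.continuous.norm).continuousOn.circleIntegrable hr0.le
    rw [lintegral_circleMap_eq_circleAverage hi fun _ => posLog_nonneg, ← ENNReal.ofReal_mul hr0.le]
    refine ENNReal.ofReal_le_ofReal ?_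
    have h1 := posLog_norm_le_circleAverage hr0 (han.mono (Set.subset_univ (closedBall z r)))
    have h2 : (0 : ℝ) ≤ log⁺ ‖F z‖ := posLog_nonneg
    have h3 : (1 / 2) * (2 * π * log⁺ ‖F z‖) ≤
        r * (2 * π * circleAverage (fun w => log⁺ ‖F w‖) z r) := by
      have := hr.1.le
      have := pi_pos
      gcongr
    linarith
  refine le_trans ?_ (setLIntegral_mono' measurableSet_Ioo key)
  rw [setLIntegral_const, Real.volume_Ioo, ← ENNReal.ofReal_mul (by have := pi_pos; have : (0 : ℝ) ≤ log⁺ ‖F z‖ := posLog_nonneg; positivity)]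
  refine ENNReal.ofReal_le_ofReal (le_of_eq (by ring))

theorem volume_im_eq_zero : volume {w : ℂ | w.im = 0} = 0 := by
  have h : LinearMap.ker Complex.imLm ≠ ⊤ := fun h => by
    have : Complex.I ∈ LinearMap.ker Complex.imLm := h ▸ Submodule.mem_top
    simp at this
  exact Measure.addHaar_submodule volume _ h

theorem setLIntegral_conj_preimage (g : ℂ → ℝ≥0∞) (s : Set ℂ) :
    ∫⁻ w in (starRingEnd ℂ) ⁻¹' s, g ((starRingEnd ℂ) w) = ∫⁻ w in s, g w :=
  Complex.conjLIE.measurePreserving.setLIntegral_comp_preimage_emb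
    Complex.conjLIE.toHomeomorph.measurableEmbedding g s

/-- A conjugation-invariant family of entire functions is locally bounded if, on a half-plane,
its members times a fixed nonzero `N` are dominated by `‖G w‖ * M / |w.im|`. -/
theorem exists_forall_norm_le_of_norm_mul_le {𝓕 : Set (ℂ → ℂ)}
    (hdiff : ∀ F ∈ 𝓕, Differentiable ℂ F)
    (hconj : ∀ F ∈ 𝓕, (fun z => (starRingEnd ℂ) (F ((starRingEnd ℂ) z))) ∈ 𝓕)
    {N : ℂ → ℂ} {c : ℂ} (hc : c.im ≠ 0)
    (hd : DifferentiableOn ℂ N {w | 0 < w.im * c.im}) (hNc : N c ≠ 0) {K : ℝ} (hK0 : 0 ≤ K)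
    (hK : ∀ w ∈ {w : ℂ | 0 < w.im * c.im}, ‖N w‖ ≤ K / |w.im|) {G : ℂ → ℂ} (hG : Continuous G)
    {M : ℝ} (hM : 0 ≤ M)
    (hF : ∀ F ∈ 𝓕, ∀ w ∈ {w : ℂ | 0 < w.im * c.im}, ‖F w‖ * ‖N w‖ ≤ ‖G w‖ * (M / |w.im|))
    (R : ℝ) : ∃ B, ∀ F ∈ 𝓕, ∀ z ∈ ball (0 : ℂ) R, ‖F z‖ ≤ B := by
  set U : Set ℂ := {w | 0 < w.im * c.im} with hU
  have hUo : IsOpen U := isOpen_lt continuous_const (Complex.continuous_im.mul_const _)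
  have hUc : IsPreconnected U := by
    refine Convex.isPreconnected ?_
    intro a ha b hb s t hs ht hst
    simp only [hU, Set.mem_ofPred_eq] at ha hb ⊢
    have : (s • a + t • b).im * c.im = s * (a.im * c.im) + t * (b.im * c.im) := by
      simp; ring
    rw [this]
    rcases hs.eq_or_lt with rfl | hs'
    · have : t = 1 := by linarith
      simpa [this] using hb
    · have := mul_pos hs' ha
      have := mul_nonneg ht hb.le
      linarith
  have hcU : c ∈ U := mul_self_pos.2 hc
  have hNae : ∀ᵐ w ∂volume.restrict U, N w ≠ 0 := by
    have han : AnalyticOnNhd ℂ N U := hd.analyticOnNhd hUo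
    have h1 := han.preimage_zero_mem_codiscreteWithin hNc hcU
      ⟨⟨c, hcU⟩, hUc⟩
    exact ae_restrict_le_codiscreteWithin hUo.measurableSet h1
  obtain ⟨BG, hBG⟩ := (isCompact_closedBall (0 : ℂ) (R + 1)).exists_bound_of_continuousOn
    hG.continuousOn
  set s := ball (0 : ℂ) (R + 1) ∩ U with hs
  have hsm : MeasurableSet s := measurableSet_ball.inter hUo.measurableSet
  set I : ℝ≥0∞ := ∫⁻ w in s, (ENNReal.ofReal (log⁺ BG) +
    ENNReal.ofReal (log⁺ (M / |w.im|) + log⁺ ‖N w‖⁻¹)) with hI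
  have hIfin : I < ⊤ := by
    rw [hI, lintegral_add_left measurable_const, setLIntegral_const]
    refine ENNReal.add_lt_top.2 ⟨ENNReal.mul_lt_top ENNReal.ofReal_lt_top ?_,
      lintegral_halfPlane_posLog_inv_lt_top hc hd hNc hK0 hK hM _⟩
    exact (measure_mono Set.inter_subset_left).trans_lt measure_ball_lt_top
  have hUint : ∀ F ∈ 𝓕, ∫⁻ w in s, ENNReal.ofReal (log⁺ ‖F w‖) ≤ I := by
    intro F hFF
    refine lintegral_mono_ae ?_
    have h1 : ∀ᵐ w ∂volume.restrict s, N w ≠ 0 :=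
      ae_mono (Measure.restrict_mono Set.inter_subset_right le_rfl) hNae
    filter_upwards [h1, ae_restrict_mem hsm] with w hw hws
    rw [← ENNReal.ofReal_add posLog_nonneg (add_nonneg posLog_nonneg posLog_nonneg)]
    refine ENNReal.ofReal_le_ofReal ?_
    have hw' : 0 < ‖N w‖ := norm_pos_iff.2 hw
    have h2 : ‖F w‖ ≤ BG * ((M / |w.im|) * ‖N w‖⁻¹) := by
      rw [← mul_assoc, ← div_eq_mul_inv, le_div_iff₀ hw']
      refine (hF F hFF w hws.2).trans ?_
      gcongr
      exact hBG w (ball_subset_closedBall hws.1)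
    exact (posLog_le_posLog (norm_nonneg _) h2).trans
      (posLog_mul.trans (add_le_add le_rfl posLog_mul))
  have hball : ∀ F ∈ 𝓕, ∫⁻ w in ball (0 : ℂ) (R + 1), ENNReal.ofReal (log⁺ ‖F w‖) ≤ I + I := by
    intro F hFF
    have hcover : ball (0 : ℂ) (R + 1) ⊆ (s ∪ (starRingEnd ℂ) ⁻¹' s) ∪ {w | w.im = 0} := by
      intro w hw
      by_cases h0 : w.im = 0
      · exact Or.inr h0
      · left
        rcases lt_or_gt_of_ne (mul_ne_zero h0 hc) with h | h
        · right
          refine ⟨by simpa using hw, ?_⟩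
          simpa [hU] using h
        · exact Or.inl ⟨hw, h⟩
    refine (lintegral_mono_set hcover).trans ((lintegral_union_le _ _ _).trans ?_)
    rw [setLIntegral_measure_zero _ _ volume_im_eq_zero, add_zero]
    refine (lintegral_union_le _ _ _).trans (add_le_add (hUint F hFF) ?_)
    refine le_trans (le_of_eq ?_) (hUint _ (hconj F hFF))
    have hinv : (starRingEnd ℂ) ⁻¹' ((starRingEnd ℂ) ⁻¹' s) = s := by ext; simp
    rw [← setLIntegral_conj_preimage, hinv]
    simp
  refine ⟨exp (2 / π * (I + I).toReal), fun F hFF z hz => ?_⟩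
  have h1 := ofReal_posLog_norm_le_lintegral_ball (hdiff F hFF) z
  have hsub : ball z 1 ⊆ ball (0 : ℂ) (R + 1) := ball_subset_ball' (by
    have := mem_ball.1 hz
    linarith)
  have h2 := h1.trans ((lintegral_mono_set hsub).trans (hball F hFF))
  have h3 := (ENNReal.ofReal_le_iff_le_toReal (ENNReal.add_lt_top.2 ⟨hIfin, hIfin⟩).ne).1 h2
  have h4 : log⁺ ‖F z‖ ≤ 2 / π * (I + I).toReal := by
    rw [div_mul_eq_mul_div, le_div_iff₀ pi_pos]
    linarith
  rcases eq_or_ne (F z) 0 with h0 | h0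
  · rw [h0, norm_zero]; positivity
  · rw [← log_le_iff_le_exp (norm_pos_iff.2 h0)]
    exact (le_max_right _ _).trans h4

end HalfPlane

/-- The function `x ↦ (x - w)⁻¹` on the one-point compactification of the real line. -/
noncomputable def cauchyKernel (w : ℂ) : C(OnePoint ℝ, ℂ) :=
  if h : w.im ≠ 0 then
    OnePoint.continuousMapMk
      ⟨fun x : ℝ => ((x : ℂ) - w)⁻¹, Continuous.inv₀ (by fun_prop) fun x hx => h (by
        have := congrArg Complex.im hx
        simpa using this)⟩ 0 (by
      rw [Filter.coclosedCompact_eq_cocompact]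
      refine tendsto_inv₀_cobounded.comp ?_
      have h1 : Tendsto (fun x : ℝ => (x : ℂ)) (cocompact ℝ) (Bornology.cobounded ℂ) := by
        rw [← Metric.cobounded_eq_cocompact]
        exact Complex.isometry_ofReal.antilipschitz.tendsto_cobounded
      rw [← tendsto_norm_atTop_iff_cobounded] at h1 ⊢
      refine tendsto_atTop_mono (fun x => norm_sub_norm_le (x : ℂ) w) ?_
      exact tendsto_atTop_add_const_right _ _ h1)
  else 0

theorem sub_ne_zero_of_im_ne_zero {w : ℂ} (hw : w.im ≠ 0) (x : ℝ) : (x : ℂ) - w ≠ 0 := fun h =>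
  hw (by
    have := congrArg Complex.im h
    simpa using this)

theorem cauchyKernel_coe {w : ℂ} (hw : w.im ≠ 0) (x : ℝ) :
    cauchyKernel w (x : OnePoint ℝ) = ((x : ℂ) - w)⁻¹ := by
  simp only [cauchyKernel, dif_pos hw]
  rfl

theorem cauchyKernel_infty (w : ℂ) : cauchyKernel w OnePoint.infty = 0 := by
  by_cases hw : w.im ≠ 0
  · simp only [cauchyKernel, dif_pos hw]
    rfl
  · simp [cauchyKernel, dif_neg hw]

theorem cauchyKernel_of_im_eq_zero {w : ℂ} (hw : w.im = 0) : cauchyKernel w = 0 := by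
  simp [cauchyKernel, hw]

theorem norm_cauchyKernel_le (w : ℂ) : ‖cauchyKernel w‖ ≤ |w.im|⁻¹ := by
  by_cases hw : w.im = 0
  · simp [cauchyKernel_of_im_eq_zero hw, hw]
  rw [ContinuousMap.norm_le _ (by positivity)]
  intro x
  induction x using OnePoint.rec with
  | infty => rw [cauchyKernel_infty, norm_zero]; positivity
  | coe x =>
    rw [cauchyKernel_coe hw, norm_inv]
    have h1 : |w.im| ≤ ‖(x : ℂ) - w‖ := by
      simpa using Complex.abs_im_le_norm ((x : ℂ) - w)
    have := abs_pos.2 hw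
    gcongr

theorem cauchyKernel_sub {w v : ℂ} (hw : w.im ≠ 0) (hv : v.im ≠ 0) :
    cauchyKernel w - cauchyKernel v = (w - v) • (cauchyKernel w * cauchyKernel v) := by
  ext x
  induction x using OnePoint.rec with
  | infty => simp [cauchyKernel_infty]
  | coe x =>
    have h1 := sub_ne_zero_of_im_ne_zero hw x
    have h2 := sub_ne_zero_of_im_ne_zero hv x
    simp only [ContinuousMap.sub_apply, ContinuousMap.smul_apply, ContinuousMap.mul_apply,
      cauchyKernel_coe hw, cauchyKernel_coe hv, smul_eq_mul]
    field_simp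
    ring

theorem star_cauchyKernel (w : ℂ) : star (cauchyKernel w) = cauchyKernel ((starRingEnd ℂ) w) := by
  by_cases hw : w.im = 0
  · rw [cauchyKernel_of_im_eq_zero hw, cauchyKernel_of_im_eq_zero (by simp [hw]), star_zero]
  ext x
  induction x using OnePoint.rec with
  | infty => simp [cauchyKernel_infty]
  | coe x => simp [cauchyKernel_coe hw, cauchyKernel_coe (w := (starRingEnd ℂ) w) (by simpa using hw)]

theorem eventually_im_ne_zero {w : ℂ} (hw : w.im ≠ 0) : ∀ᶠ v in nhds w, v.im ≠ 0 :=
  (Complex.continuous_im.continuousAt (x := w)).eventually_ne hw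

theorem continuousAt_cauchyKernel {w : ℂ} (hw : w.im ≠ 0) : ContinuousAt cauchyKernel w := by
  rw [ContinuousAt, tendsto_iff_norm_sub_tendsto_zero]
  have h1 : Tendsto (fun v : ℂ => ‖v - w‖ * (|v.im|⁻¹ * |w.im|⁻¹)) (nhds w) (nhds 0) := by
    have : ContinuousAt (fun v : ℂ => ‖v - w‖ * (|v.im|⁻¹ * |w.im|⁻¹)) w := by
      have h := abs_ne_zero.2 hw
      have h2 : ContinuousAt (fun v : ℂ => |v.im|) w := by fun_prop
      exact (by fun_prop : ContinuousAt (fun v : ℂ => ‖v - w‖) w).mul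
        ((h2.inv₀ h).mul continuousAt_const)
    simpa [ContinuousAt] using this
  refine tendsto_of_tendsto_of_tendsto_of_le_of_le' tendsto_const_nhds h1
    (Eventually.of_forall fun _ => norm_nonneg _) ?_
  filter_upwards [eventually_im_ne_zero hw] with v hv
  rw [cauchyKernel_sub hv hw, norm_smul]
  gcongr
  exact (norm_mul_le _ _).trans (mul_le_mul (norm_cauchyKernel_le v) (norm_cauchyKernel_le w)
    (norm_nonneg _) (by positivity))

theorem hasDerivAt_cauchyKernel {w : ℂ} (hw : w.im ≠ 0) :
    HasDerivAt cauchyKernel (cauchyKernel w * cauchyKernel w) w := by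
  rw [hasDerivAt_iff_tendsto_slope]
  have h1 : Tendsto (fun v => cauchyKernel v * cauchyKernel w) (nhdsWithin w {w}ᶜ)
      (nhds (cauchyKernel w * cauchyKernel w)) :=
    ((continuousAt_cauchyKernel hw).mul continuousAt_const).mono_left nhdsWithin_le_nhds
  refine h1.congr' ?_
  filter_upwards [nhdsWithin_le_nhds (eventually_im_ne_zero hw), self_mem_nhdsWithin] with v hv hvw
  rw [slope_def_module, cauchyKernel_sub hv hw, smul_smul, inv_mul_cancel₀ (sub_ne_zero.2 hvw),
    one_smul]

/-- The constants and the Cauchy kernels span a dense subspace of `C(OnePoint ℝ, ℂ)`. -/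
theorem topologicalClosure_span_cauchyKernel :
    (Submodule.span ℂ (insert 1 (Set.range cauchyKernel))).topologicalClosure = ⊤ := by
  set W := (Submodule.span ℂ (insert 1 (Set.range cauchyKernel))).topologicalClosure with hW
  have hWc : IsClosed (W : Set C(OnePoint ℝ, ℂ)) := Submodule.isClosed_topologicalClosure _
  have h1 : (1 : C(OnePoint ℝ, ℂ)) ∈ W :=
    Submodule.le_topologicalClosure _ (Submodule.subset_span (Set.mem_insert _ _))
  have hr : ∀ w, cauchyKernel w ∈ W := fun w =>
    Submodule.le_topologicalClosure _ (Submodule.subset_span (Set.mem_insert_of_mem _ ⟨w, rfl⟩))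
  have hne : ∀ w v, w.im ≠ 0 → v.im ≠ 0 → w ≠ v → cauchyKernel w * cauchyKernel v ∈ W := by
    intro w v hw hv hwv
    have h2 : cauchyKernel w * cauchyKernel v = (w - v)⁻¹ • (cauchyKernel w - cauchyKernel v) := by
      rw [cauchyKernel_sub hw hv, smul_smul, inv_mul_cancel₀ (sub_ne_zero.2 hwv), one_smul]
    rw [h2]
    exact W.smul_mem _ (W.sub_mem (hr w) (hr v))
  have hmul : ∀ w v, cauchyKernel w * cauchyKernel v ∈ W := by
    intro w v
    by_cases hw : w.im = 0
    · simp [cauchyKernel_of_im_eq_zero hw]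
    by_cases hv : v.im = 0
    · simp [cauchyKernel_of_im_eq_zero hv]
    rcases eq_or_ne w v with rfl | hwv
    · have h2 : Tendsto (fun v => cauchyKernel v * cauchyKernel w) (nhdsWithin w {w}ᶜ)
          (nhds (cauchyKernel w * cauchyKernel w)) :=
        ((continuousAt_cauchyKernel hw).mul continuousAt_const).mono_left nhdsWithin_le_nhds
      refine hWc.mem_of_tendsto h2 ?_
      filter_upwards [nhdsWithin_le_nhds (eventually_im_ne_zero hw), self_mem_nhdsWithin]
        with u hu huw
      exact hne u w hu hw huw
    · exact hne w v hw hv hwv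
  have hstep : ∀ w, ∀ a ∈ W, cauchyKernel w * a ∈ W := by
    intro w a ha
    have hle : W ≤ W.comap (LinearMap.mulLeft ℂ (cauchyKernel w)) := by
      refine Submodule.topologicalClosure_minimal _ ?_
        (hWc.preimage (continuous_const.mul continuous_id))
      rw [Submodule.span_le]
      rintro b (rfl | ⟨v, rfl⟩)
      · simpa using hr w
      · exact hmul w v
    exact hle ha
  set A := StarAlgebra.adjoin ℂ (Set.range cauchyKernel) with hA
  have hAW : ∀ a ∈ A, a ∈ W := by
    intro a ha
    have ha' : a ∈ Submodule.span ℂ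
        (Submonoid.closure (Set.range cauchyKernel ∪ star (Set.range cauchyKernel)) :
          Set C(OnePoint ℝ, ℂ)) := by
      rw [← StarAlgebra.adjoin_eq_span]
      exact ha
    refine Submodule.span_le.2 ?_ ha'
    intro b hb
    induction hb using Submonoid.closure_induction_left with
    | one => exact h1
    | mul_left x hx y _ hy =>
      rcases hx with ⟨w, rfl⟩ | ⟨w, hw⟩
      · exact hstep w y hy
      · have : x = cauchyKernel ((starRingEnd ℂ) w) := by
          rw [← star_cauchyKernel, hw, star_star]
        rw [this]
        exact hstep _ y hy
  have hsep : A.SeparatesPoints := by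
    intro x y hxy
    refine ⟨cauchyKernel Complex.I, ⟨cauchyKernel Complex.I,
      StarAlgebra.subset_adjoin ℂ _ ⟨_, rfl⟩, rfl⟩, ?_⟩
    have hI : Complex.I.im ≠ 0 := by simp
    induction x using OnePoint.rec with
    | infty =>
      induction y using OnePoint.rec with
      | infty => exact absurd rfl hxy
      | coe y =>
        rw [cauchyKernel_infty, cauchyKernel_coe hI]
        exact (inv_ne_zero (sub_ne_zero_of_im_ne_zero hI y)).symm
    | coe x =>
      induction y using OnePoint.rec with
      | infty =>
        rw [cauchyKernel_infty, cauchyKernel_coe hI]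
        exact inv_ne_zero (sub_ne_zero_of_im_ne_zero hI x)
      | coe y =>
        rw [cauchyKernel_coe hI, cauchyKernel_coe hI]
        intro h
        exact hxy (by simpa using h)
  have htop := ContinuousMap.starSubalgebra_topologicalClosure_eq_top_of_separatesPoints A hsep
  rw [eq_top_iff]
  intro a _
  have ha : a ∈ A.topologicalClosure := htop ▸ StarSubalgebra.mem_top
  exact closure_minimal hAW hWc ha

theorem IsAlgebraicDeBranges.exists_apply_ne_zero {L : Submodule ℂ (ℂ → ℂ)}
    (hdb : IsAlgebraicDeBranges L) (hL : L ≠ ⊥) (w : ℂ) : ∃ G ∈ L, G w ≠ 0 := by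
  obtain ⟨F, hF, hF0⟩ := L.ne_bot_iff.1 hL
  have key : ∀ n : ℕ, ∀ F ∈ L, ∀ g : ℂ → ℂ, ContinuousAt g w → g w ≠ 0 →
      (∀ᶠ z in nhds w, F z = (z - w) ^ n • g z) → ∃ G ∈ L, G w ≠ 0 := by
    intro n
    induction n with
    | zero =>
      intro F hF g _ hgw h
      exact ⟨F, hF, by simpa [h.self_of_nhds] using hgw⟩
    | succ n ih =>
      intro F hF g hg hgw h
      obtain ⟨G, hG, hGF⟩ := hdb.2.1 F hF w (by simp [h.self_of_nhds])
      refine ih G hG g hg hgw ?_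
      have hGc : ContinuousAt G w := (hdb.1 G hG).continuous.continuousAt
      have hgc : ContinuousAt (fun z => (z - w) ^ n • g z) w :=
        (by fun_prop : ContinuousAt (fun z : ℂ => (z - w) ^ n) w).smul hg
      refine (hGc.eventuallyEq_nhds_iff_eventuallyEq_nhdsNE hgc).1 ?_
      filter_upwards [nhdsWithin_le_nhds h, self_mem_nhdsWithin] with z hz hzw
      have : z - w ≠ 0 := sub_ne_zero.2 hzw
      simp only [hGF z hzw, hz, smul_eq_mul, pow_succ]
      field_simp
  have han : AnalyticAt ℂ F w := (hdb.1 F hF).analyticAt w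
  have hne : ¬ ∀ᶠ z in nhds w, F z = 0 := by
    intro h
    refine hF0 (funext fun z => ?_)
    have h1 : AnalyticOnNhd ℂ F Set.univ := fun z _ => (hdb.1 F hF).analyticAt z
    exact h1.eqOn_zero_of_preconnected_of_eventuallyEq_zero isPreconnected_univ
      (Set.mem_univ w) h (Set.mem_univ z)
  obtain ⟨n, g, hg, hgw, h⟩ := han.exists_eventuallyEq_pow_smul_nonzero_iff.2 hne
  exact key n F hF g hg.continuousAt hgw h

theorem integrable_continuousMap_mul {μ : Measure ℝ} {g : ℝ → ℂ} (hg : Integrable g μ)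
    (a : C(OnePoint ℝ, ℂ)) : Integrable (fun x : ℝ => a (x : OnePoint ℝ) * g x) μ :=
  hg.bdd_mul (c := ‖a‖) (a.continuous.comp OnePoint.continuous_coe).aestronglyMeasurable
    (Eventually.of_forall fun _ => a.norm_coe_le_norm _)

/-- Multiplication of a fixed integrable function by continuous functions on `OnePoint ℝ`. -/
noncomputable def mulL1 {μ : Measure ℝ} {g : ℝ → ℂ} (hg : Integrable g μ) :
    C(OnePoint ℝ, ℂ) →L[ℂ] Lp ℂ 1 μ :=
  LinearMap.mkContinuous
    { toFun := fun a => (integrable_continuousMap_mul hg a).toL1 _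
      map_add' := fun a b => by
        rw [← Integrable.toL1_add]
        congr 1
        ext x
        simp [add_mul]
      map_smul' := fun c a => by
        rw [RingHom.id_apply, ← Integrable.toL1_smul]
        congr 1
        ext x
        simp [mul_assoc] } ‖hg.toL1 g‖ fun a => by
    simp only [LinearMap.coe_mk, AddHom.coe_mk]
    rw [L1.norm_of_fun_eq_integral_norm, L1.norm_of_fun_eq_integral_norm, ← integral_mul_const]
    refine integral_mono (integrable_continuousMap_mul hg a).norm (hg.norm.mul_const _) fun x => ?_
    simp only [norm_mul]
    rw [mul_comm]
    gcongr
    exact a.norm_coe_le_norm _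

theorem mulL1_apply {μ : Measure ℝ} {g : ℝ → ℂ} (hg : Integrable g μ) (a : C(OnePoint ℝ, ℂ)) :
    mulL1 hg a = (integrable_continuousMap_mul hg a).toL1 _ := rfl

theorem norm_mulL1_le {μ : Measure ℝ} {g : ℝ → ℂ} (hg : Integrable g μ) :
    ‖mulL1 hg‖ ≤ ‖hg.toL1 g‖ :=
  LinearMap.mkContinuous_norm_le _ (norm_nonneg _) _

theorem norm_toL1_eq_toReal {μ : Measure ℝ} {g : ℝ → ℂ} (hg : Integrable g μ) :
    ‖hg.toL1 g‖ = (∫⁻ x, (‖g x‖₊ : ℝ≥0∞) ∂μ).toReal := by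
  rw [Integrable.norm_toL1_eq_lintegral_norm]
  simp [ofReal_norm, enorm]

theorem IsAlgebraicDeBranges.integrable {μ : Measure ℝ} {L : Submodule ℂ (ℂ → ℂ)}
    (hdb : IsAlgebraicDeBranges L)
    (hint : ∀ F ∈ L, (∫⁻ x : ℝ, (‖F (x : ℂ)‖₊ : ℝ≥0∞) ∂μ) < ⊤) {F : ℂ → ℂ} (hF : F ∈ L) :
    Integrable (fun x : ℝ => F x) μ :=
  ⟨((hdb.1 F hF).continuous.comp Complex.continuous_ofReal).aestronglyMeasurable, hint F hF⟩

/-- If `L` is not dense in `L¹(μ)`, a nonzero continuous functional vanishes on it. -/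
theorem exists_annihilator_of_not_denseL1 {μ : Measure ℝ} {L : Submodule ℂ (ℂ → ℂ)}
    (hi : ∀ F ∈ L, Integrable (fun x : ℝ => F x) μ) (hnd : ¬ DenseL1 μ L) :
    ∃ Λ : Lp ℂ 1 μ →L[ℂ] ℂ, Λ ≠ 0 ∧ ∀ F (hF : F ∈ L), Λ ((hi F hF).toL1 _) = 0 := by
  let T : L →ₗ[ℂ] Lp ℂ 1 μ :=
    { toFun := fun F => (hi F.1 F.2).toL1 _
      map_add' := fun F G => by rw [← Integrable.toL1_add]; rfl
      map_smul' := fun c F => by rw [RingHom.id_apply, ← Integrable.toL1_smul]; rfl }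
  simp only [DenseL1, not_forall] at hnd
  obtain ⟨f, hf, hnf⟩ := hnd
  have hmem : hf.toL1 f ∉ (T.range.topologicalClosure : Set (Lp ℂ 1 μ)) := by
    intro h
    refine hnf ⟨hf, fun ε hε => ?_⟩
    rw [Submodule.topologicalClosure_coe, Metric.mem_closure_iff] at h
    obtain ⟨_, ⟨F, rfl⟩, hd⟩ := h ε hε
    refine ⟨F.1, F.2, ?_⟩
    have h1 := edist_lt_ofReal.2 hd
    have h2 : edist (hf.toL1 f) (T F) = ∫⁻ x, edist (f x) (F.1 (x : ℂ)) ∂μ :=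
      Integrable.edist_toL1_toL1 _ _ hf (hi F.1 F.2)
    rw [h2] at h1
    simpa [edist_eq_enorm_sub, enorm] using h1
  obtain ⟨Λ, u, h1, h2⟩ := RCLike.geometric_hahn_banach_closed_point (𝕜 := ℂ)
    (T.range.topologicalClosure.restrictScalars ℝ).convex
    (Submodule.isClosed_topologicalClosure _) hmem
  have h0 : 0 < u := by simpa using h1 0 (Submodule.zero_mem _)
  refine ⟨Λ, fun h => ?_, fun F hF => ?_⟩
  · rw [h] at h2
    simp at h2
    linarith
  · by_contra hne
    have h3 := h1 (((u + 1 : ℝ) / Λ (T ⟨F, hF⟩) : ℂ) • T ⟨F, hF⟩)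
      (Submodule.smul_mem _ _ (Submodule.le_topologicalClosure _ (LinearMap.mem_range_self T ⟨F, hF⟩)))
    have h4 : Λ (T ⟨F, hF⟩) ≠ 0 := hne
    rw [map_smul, smul_eq_mul, div_mul_cancel₀ _ h4] at h3
    simp at h3
    linarith

theorem toL1_mem_of_forall_mulL1_mem {μ : Measure ℝ} {L : Submodule ℂ (ℂ → ℂ)}
    (hi : ∀ F ∈ L, Integrable (fun x : ℝ => F x) μ) {V : Submodule ℂ (Lp ℂ 1 μ)}
    (h : ∀ G (hG : G ∈ L) a, mulL1 (hi G hG) a ∈ V) (b : L → C(OnePoint ℝ, ℂ))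
    (s : Finset L) {v : ℝ → ℂ} (hv : Integrable v μ)
    (hvb : ∀ x : ℝ, v x = ∑ G ∈ s, b G (x : OnePoint ℝ) * G.1 x) : hv.toL1 v ∈ V := by
  classical
  induction s using Finset.induction_on generalizing v with
  | empty =>
    obtain rfl : v = 0 := by
      ext x
      simp [hvb]
    simp
  | insert G s hG ih =>
    have h2 : Integrable (fun x : ℝ => ∑ G ∈ s, b G (x : OnePoint ℝ) * G.1 x) μ :=
      integrable_finsetSum _ fun G _ => integrable_continuousMap_mul (hi G.1 G.2) (b G)
    have h3 : hv.toL1 v = mulL1 (hi G.1 G.2) (b G) + h2.toL1 _ := by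
      rw [mulL1_apply, ← Integrable.toL1_add]
      congr 1
      ext x
      simp [hvb, Finset.sum_insert hG]
    rw [h3]
    exact V.add_mem (h G.1 G.2 _) (ih h2 fun _ => rfl)

theorem IsAlgebraicDeBranges.toL1_mem_of_hasCompactSupport {μ : Measure ℝ}
    {L : Submodule ℂ (ℂ → ℂ)} (hdb : IsAlgebraicDeBranges L)
    (hi : ∀ F ∈ L, Integrable (fun x : ℝ => F x) μ) (hL : L ≠ ⊥) {V : Submodule ℂ (Lp ℂ 1 μ)}
    (h : ∀ G (hG : G ∈ L) a, mulL1 (hi G hG) a ∈ V) {u : ℝ → ℂ} (hu : Integrable u μ)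
    (huc : Continuous u) (hus : HasCompactSupport u) : hu.toL1 u ∈ V := by
  have hcont : ∀ G : L, Continuous fun x : ℝ => G.1 x := fun G =>
    (hdb.1 G.1 G.2).continuous.comp Complex.continuous_ofReal
  obtain ⟨t, ht⟩ := hus.isCompact.elim_finite_subcover (fun G : L => {x : ℝ | G.1 x ≠ 0})
    (fun G => isOpen_ne_fun (hcont G) continuous_const) fun x _ => by
      obtain ⟨G, hG, hGx⟩ := hdb.exists_apply_ne_zero hL x
      exact Set.mem_iUnion.2 ⟨⟨G, hG⟩, hGx⟩
  set q : ℝ → ℂ := fun x => ∑ G ∈ t, (starRingEnd ℂ) (G.1 x) * G.1 x with hq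
  have hq0 : ∀ x ∈ tsupport u, q x ≠ 0 := by
    intro x hx h0
    have h1 : q x = ((∑ G ∈ t, ‖G.1 x‖ ^ 2 : ℝ) : ℂ) := by
      simp only [hq, Complex.conj_mul']
      push_cast
      rfl
    rw [h1, Complex.ofReal_eq_zero, Finset.sum_eq_zero_iff_of_nonneg fun _ _ => by positivity] at h0
    obtain ⟨G, hG, hGx⟩ := Set.mem_iUnion₂.1 (ht hx)
    exact hGx (by simpa using h0 G hG)
  have hqc : Continuous q :=
    continuous_finsetSum _ fun G _ => (Complex.continuous_conj.comp (hcont G)).mul (hcont G)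
  have hac : Continuous fun x => u x / q x := by
    rw [continuous_iff_continuousAt]
    intro x
    by_cases hx : x ∈ tsupport u
    · exact huc.continuousAt.div hqc.continuousAt (hq0 x hx)
    · have h0 : (fun x => u x / q x) =ᶠ[nhds x] fun _ => 0 := by
        filter_upwards [notMem_tsupport_iff_eventuallyEq.1 hx] with y hy
        simp [hy]
      exact continuousAt_const.congr h0.symm
  have has : HasCompactSupport fun x => u x / q x := by
    simp only [div_eq_mul_inv]
    exact hus.mul_right
  let b : L → C(OnePoint ℝ, ℂ) := fun G =>
    OnePoint.continuousMapMk
      ⟨fun x => (starRingEnd ℂ) (G.1 x) * (u x / q x),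
        (Complex.continuous_conj.comp (hcont G)).mul hac⟩ 0 (by
        rw [Filter.coclosedCompact_eq_cocompact]
        exact has.mul_left.is_zero_at_infty)
  refine toL1_mem_of_forall_mulL1_mem hi h b t hu fun x => ?_
  have hb : ∀ G : L, b G (x : OnePoint ℝ) = (starRingEnd ℂ) (G.1 x) * (u x / q x) := fun _ => rfl
  have h1 : ∑ G ∈ t, b G (x : OnePoint ℝ) * G.1 x = q x * (u x / q x) := by
    rw [hq, Finset.sum_mul]
    refine Finset.sum_congr rfl fun G _ => ?_
    rw [hb]
    ring
  rw [h1]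
  by_cases hx : x ∈ tsupport u
  · rw [mul_div_cancel₀ _ (hq0 x hx)]
  · simp [image_eq_zero_of_notMem_tsupport hx]

theorem IsAlgebraicDeBranges.eq_zero_of_mulL1_eq_zero {μ : Measure ℝ} [IsLocallyFiniteMeasure μ]
    {L : Submodule ℂ (ℂ → ℂ)} (hdb : IsAlgebraicDeBranges L)
    (hi : ∀ F ∈ L, Integrable (fun x : ℝ => F x) μ) (hL : L ≠ ⊥) {Λ : Lp ℂ 1 μ →L[ℂ] ℂ}
    (h : ∀ G (hG : G ∈ L) a, Λ (mulL1 (hi G hG) a) = 0) : Λ = 0 := by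
  ext φ
  have hcl : IsClosed (Λ.ker : Set (Lp ℂ 1 μ)) := Λ.isClosed_ker
  have hφ : φ ∈ (Λ.ker : Set (Lp ℂ 1 μ)) := by
    rw [← hcl.closure_eq, Metric.mem_closure_iff]
    intro ε hε
    obtain ⟨g, hgs, hle, hgc, hg⟩ :=
      (L1.integrable_coeFn φ).exists_hasCompactSupport_integral_sub_le (half_pos hε)
    refine ⟨hg.toL1 g, hdb.toL1_mem_of_hasCompactSupport hi hL (V := Λ.ker) h hg hgc hgs, ?_⟩
    have h1 : φ - hg.toL1 g = ((L1.integrable_coeFn φ).sub hg).toL1 _ := by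
      rw [Integrable.toL1_sub _ _ (L1.integrable_coeFn φ) hg, Integrable.toL1_coeFn]
    rw [dist_eq_norm, h1, L1.norm_of_fun_eq_integral_norm]
    exact lt_of_le_of_lt hle (half_lt_self hε)
  exact hφ

theorem IsAlgebraicDeBranges.exists_mulL1_cauchyKernel_ne_zero {μ : Measure ℝ}
    [IsLocallyFiniteMeasure μ] {L : Submodule ℂ (ℂ → ℂ)} (hdb : IsAlgebraicDeBranges L)
    (hi : ∀ F ∈ L, Integrable (fun x : ℝ => F x) μ) (hL : L ≠ ⊥) {Λ : Lp ℂ 1 μ →L[ℂ] ℂ}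
    (hΛ : Λ ≠ 0) (hΛL : ∀ F (hF : F ∈ L), Λ ((hi F hF).toL1 _) = 0) :
    ∃ G, ∃ hG : G ∈ L, ∃ c : ℂ, c.im ≠ 0 ∧ Λ (mulL1 (hi G hG) (cauchyKernel c)) ≠ 0 := by
  by_contra! hcon
  refine hΛ (hdb.eq_zero_of_mulL1_eq_zero hi hL fun G hG a => ?_)
  have hle : (Submodule.span ℂ (insert 1 (Set.range cauchyKernel))).topologicalClosure
      ≤ (Λ ∘L mulL1 (hi G hG)).ker := by
    refine Submodule.topologicalClosure_minimal _ (Submodule.span_le.2 ?_)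
      (Λ ∘L mulL1 (hi G hG)).isClosed_ker
    rintro _ (rfl | ⟨w, rfl⟩)
    · have : mulL1 (hi G hG) 1 = (hi G hG).toL1 _ := by
        rw [mulL1_apply]
        congr 1
        ext x
        simp
      simpa [this] using hΛL G hG
    · by_cases hw : w.im = 0
      · simp [cauchyKernel_of_im_eq_zero hw]
      · simpa using hcon G hG w hw
  rw [topologicalClosure_span_cauchyKernel] at hle
  exact hle (Submodule.mem_top (x := a))

theorem IsAlgebraicDeBranges.apply_mul_mulL1_cauchyKernel {μ : Measure ℝ}
    {L : Submodule ℂ (ℂ → ℂ)} (hdb : IsAlgebraicDeBranges L)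
    (hi : ∀ F ∈ L, Integrable (fun x : ℝ => F x) μ) {Λ : Lp ℂ 1 μ →L[ℂ] ℂ}
    (hΛL : ∀ F (hF : F ∈ L), Λ ((hi F hF).toL1 _) = 0) {F G : ℂ → ℂ} (hF : F ∈ L) (hG : G ∈ L)
    {w : ℂ} (hw : w.im ≠ 0) :
    F w * Λ (mulL1 (hi G hG) (cauchyKernel w)) = G w * Λ (mulL1 (hi F hF) (cauchyKernel w)) := by
  obtain ⟨E, hE, hEH⟩ := hdb.2.1 (G w • F - F w • G)
    (L.sub_mem (L.smul_mem _ hF) (L.smul_mem _ hG)) w (by simp [mul_comm])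
  have h1 : (hi E hE).toL1 _ = G w • mulL1 (hi F hF) (cauchyKernel w)
      - F w • mulL1 (hi G hG) (cauchyKernel w) := by
    rw [mulL1_apply, mulL1_apply, ← Integrable.toL1_smul, ← Integrable.toL1_smul,
      ← Integrable.toL1_sub]
    congr 1
    ext x
    have h2 := sub_ne_zero_of_im_ne_zero hw x
    simp only [hEH x (sub_ne_zero.1 h2), Pi.sub_apply, Pi.smul_apply, smul_eq_mul,
      cauchyKernel_coe hw]
    field_simp
  have h3 := hΛL E hE
  rw [h1, map_sub, map_smul, map_smul, sub_eq_zero] at h3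
  exact h3.symm

theorem IsAlgebraicDeBranges.exists_forall_norm_le {μ : Measure ℝ} [IsLocallyFiniteMeasure μ]
    {L : Submodule ℂ (ℂ → ℂ)} (hdb : IsAlgebraicDeBranges L)
    (hint : ∀ F ∈ L, (∫⁻ x : ℝ, (‖F (x : ℂ)‖₊ : ℝ≥0∞) ∂μ) < ⊤) (hnd : ¬ DenseL1 μ L) (R : ℝ) :
    ∃ B : ℝ, ∀ F ∈ L, (∫⁻ x : ℝ, (‖F (x : ℂ)‖₊ : ℝ≥0∞) ∂μ) ≤ 1 →
      ∀ z ∈ Metric.ball (0 : ℂ) R, ‖F z‖ ≤ B := by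
  rcases eq_or_ne L ⊥ with rfl | hL
  · refine ⟨0, fun F hF _ z _ => ?_⟩
    rw [(Submodule.mem_bot ℂ).1 hF]
    simp
  have hi : ∀ F ∈ L, Integrable (fun x : ℝ => F x) μ := fun F hF => hdb.integrable hint hF
  obtain ⟨Λ, hΛ, hΛL⟩ := exists_annihilator_of_not_denseL1 hi hnd
  obtain ⟨G, hG, c, hc, hNc⟩ := hdb.exists_mulL1_cauchyKernel_ne_zero hi hL hΛ hΛL
  have hN : ∀ F (hF : F ∈ L) (w : ℂ), ‖Λ (mulL1 (hi F hF) (cauchyKernel w))‖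
      ≤ ‖Λ‖ * ‖(hi F hF).toL1 _‖ / |w.im| := by
    intro F hF w
    rw [div_eq_mul_inv, mul_assoc]
    refine (Λ.le_opNorm _).trans ?_
    gcongr
    refine ((mulL1 (hi F hF)).le_opNorm _).trans ?_
    gcongr
    · exact norm_mulL1_le _
    · exact norm_cauchyKernel_le w
  have him : ∀ w ∈ {w : ℂ | 0 < w.im * c.im}, w.im ≠ 0 := by
    intro w hw h
    simp [h] at hw
  obtain ⟨B, hB⟩ := exists_forall_norm_le_of_norm_mul_le
    (𝓕 := {F | F ∈ L ∧ (∫⁻ x : ℝ, (‖F (x : ℂ)‖₊ : ℝ≥0∞) ∂μ) ≤ 1})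
    (fun F hF => hdb.1 F hF.1)
    (fun F hF => ⟨hdb.2.2 F hF.1, by simpa using hF.2⟩)
    (N := fun w => Λ (mulL1 (hi G hG) (cauchyKernel w))) hc
    (fun w hw => ((Λ ∘L mulL1 (hi G hG)).hasFDerivAt.comp_hasDerivAt w
      (hasDerivAt_cauchyKernel (him w hw))).differentiableAt.differentiableWithinAt)
    hNc (K := ‖Λ‖ * ‖(hi G hG).toL1 _‖) (by positivity) (fun w _ => hN G hG w)
    (hdb.1 G hG).continuous (norm_nonneg Λ)
    (fun F hF w hw => by
      rw [← norm_mul, hdb.apply_mul_mulL1_cauchyKernel hi hΛL hF.1 hG (him w hw), norm_mul]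
      gcongr
      refine (hN F hF.1 w).trans ?_
      gcongr
      refine mul_le_of_le_one_right (norm_nonneg _) ?_
      rw [norm_toL1_eq_toReal]
      simpa using ENNReal.toReal_mono ENNReal.one_ne_top hF.2) R
  exact ⟨B, fun F hF h1 z hz => hB F ⟨hF, h1⟩ z hz⟩

theorem nnnorm_apply_le_L1Majorant_mul {μ : Measure ℝ} {L : Submodule ℂ (ℂ → ℂ)}
    (hint : ∀ F ∈ L, (∫⁻ x : ℝ, (‖F (x : ℂ)‖₊ : ℝ≥0∞) ∂μ) < ⊤)
    (hinj : ∀ F ∈ L, (∫⁻ x : ℝ, (‖F (x : ℂ)‖₊ : ℝ≥0∞) ∂μ) = 0 → F = 0)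
    {F : ℂ → ℂ} (hF : F ∈ L) (z : ℂ) :
    (‖F z‖₊ : ℝ≥0∞) ≤ L1Majorant μ L z * ∫⁻ x : ℝ, (‖F (x : ℂ)‖₊ : ℝ≥0∞) ∂μ := by
  by_cases h0 : (∫⁻ x : ℝ, (‖F (x : ℂ)‖₊ : ℝ≥0∞) ∂μ) = 0
  · simp [hinj F hF h0]
  set I := ∫⁻ x : ℝ, (‖F (x : ℂ)‖₊ : ℝ≥0∞) ∂μ with hI
  have htop : I ≠ ⊤ := (hint F hF).ne
  have hr : I.toNNReal ≠ 0 := fun h => (ENNReal.toNNReal_eq_zero_iff _).1 h |>.elim h0 htop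
  have hs : ∀ w, (‖(((I.toNNReal⁻¹ : ℝ≥0) : ℂ) • F) w‖₊ : ℝ≥0∞) = I⁻¹ * ‖F w‖₊ := by
    intro w
    have h1 : ‖(((I.toNNReal⁻¹ : ℝ≥0) : ℂ))‖₊ = I.toNNReal⁻¹ := by
      ext
      simp
    rw [Pi.smul_apply, nnnorm_smul, h1, ENNReal.coe_mul, ENNReal.coe_inv hr,
      ENNReal.coe_toNNReal htop]
  have h2 : I⁻¹ * ‖F z‖₊ ≤ L1Majorant μ L z := by
    rw [← hs z]
    refine le_iSup_of_le ⟨((I.toNNReal⁻¹ : ℝ≥0) : ℂ) • F, L.smul_mem _ hF, ?_⟩ le_rfl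
    simp only [hs]
    rw [lintegral_const_mul' _ _ (ENNReal.inv_ne_top.2 h0), ENNReal.inv_mul_cancel h0 htop]
  calc (‖F z‖₊ : ℝ≥0∞) = I⁻¹ * ‖F z‖₊ * I := by
        rw [mul_right_comm, ENNReal.inv_mul_cancel h0 htop, one_mul]
    _ ≤ _ := by gcongr

theorem IsAlgebraicDeBranges.exists_L1Majorant_le {μ : Measure ℝ} [IsLocallyFiniteMeasure μ]
    {L : Submodule ℂ (ℂ → ℂ)} (hdb : IsAlgebraicDeBranges L)
    (hint : ∀ F ∈ L, (∫⁻ x : ℝ, (‖F (x : ℂ)‖₊ : ℝ≥0∞) ∂μ) < ⊤) (hnd : ¬ DenseL1 μ L) (R : ℝ) :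
    ∃ B : ℝ, 0 ≤ B ∧ ∀ z ∈ Metric.ball (0 : ℂ) R, L1Majorant μ L z ≤ ENNReal.ofReal B := by
  obtain ⟨B, hB⟩ := hdb.exists_forall_norm_le hint hnd R
  refine ⟨max B 0, le_max_right _ _, fun z hz => iSup_le fun F => ?_⟩
  have h1 := (hB F.1 F.2.1 F.2.2 z hz).trans (le_max_left B 0)
  simpa [ofReal_norm, enorm] using ENNReal.ofReal_le_ofReal h1

/-- Pitt's theorem, second part: each element `f` of the `L¹(μ)`-closure of `𝓛`
coincides `μ`-a.e. with the restriction of an entire function `F` satisfying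
`|F(z)| ≤ 𝔪(z)·‖f‖_{L¹(μ)}` for all `z`. -/
theorem stmt11 (μ : Measure ℝ) [IsLocallyFiniteMeasure μ]
    (L : Submodule ℂ (ℂ → ℂ)) (hdb : IsAlgebraicDeBranges L)
    (hint : ∀ F ∈ L, (∫⁻ x : ℝ, (‖F (x : ℂ)‖₊ : ℝ≥0∞) ∂μ) < ⊤)
    (hinj : ∀ F ∈ L, (∫⁻ x : ℝ, (‖F (x : ℂ)‖₊ : ℝ≥0∞) ∂μ) = 0 → F = 0)
    (hnd : ¬ DenseL1 μ L)
    (f : ℝ → ℂ) (hf : MemClosL1 μ L f) :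
    ∃ F : ℂ → ℂ, Differentiable ℂ F ∧ (∀ᵐ x ∂μ, f x = F (x : ℂ)) ∧
      ∀ z : ℂ, (‖F z‖₊ : ℝ≥0∞) ≤ L1Majorant μ L z * ∫⁻ x : ℝ, (‖f x‖₊ : ℝ≥0∞) ∂μ := by
  obtain ⟨hfi, hcl⟩ := hf
  choose u huL hu using fun n : ℕ => hcl (1 / ((n : ℝ) + 1)) (by positivity)
  choose B hB0 hB using fun R : ℝ => hdb.exists_L1Majorant_le hint hnd R
  have hui : ∀ n, Integrable (fun x : ℝ => u n x) μ := fun n => hdb.integrable hint (huL n)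
  have hdist : ∀ n m : ℕ, (∫⁻ x : ℝ, (‖(u n - u m) (x : ℂ)‖₊ : ℝ≥0∞) ∂μ)
      ≤ ENNReal.ofReal (1 / ((n : ℝ) + 1) + 1 / ((m : ℝ) + 1)) := by
    intro n m
    rw [ENNReal.ofReal_add (by positivity) (by positivity)]
    refine le_trans ?_ (add_le_add (hu n).le (hu m).le)
    refine le_trans ?_ (lintegral_add_left' (hfi.sub (hui n)).aestronglyMeasurable.enorm _).le
    refine lintegral_mono fun x => ?_
    have h1 : (u n - u m) (x : ℂ) = (f x - u m x) - (f x - u n x) := by simp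
    rw [h1, add_comm]
    exact enorm_sub_le
  have hbd : ∀ R, ∀ z ∈ Metric.ball (0 : ℂ) R, ∀ n m N : ℕ, N ≤ n → N ≤ m →
      dist (u n z) (u m z) ≤ B R * (2 / ((N : ℝ) + 1)) := by
    intro R z hz n m N hn hm
    have h1 := nnnorm_apply_le_L1Majorant_mul hint hinj (L.sub_mem (huL n) (huL m)) z
    have h2 := h1.trans (mul_le_mul' (hB R z hz) (hdist n m))
    rw [← ENNReal.ofReal_mul (hB0 R), ← enorm_eq_nnnorm, ← ofReal_norm,
      ENNReal.ofReal_le_ofReal_iff (mul_nonneg (hB0 R) (by positivity))] at h2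
    rw [dist_eq_norm]
    refine h2.trans (mul_le_mul_of_nonneg_left ?_ (hB0 R))
    have h3 : 1 / ((n : ℝ) + 1) ≤ 1 / ((N : ℝ) + 1) := by gcongr
    have h4 : 1 / ((m : ℝ) + 1) ≤ 1 / ((N : ℝ) + 1) := by gcongr
    calc _ ≤ 1 / ((N : ℝ) + 1) + 1 / ((N : ℝ) + 1) := add_le_add h3 h4
      _ = _ := by ring
  have hlim : ∀ R, Tendsto (fun N : ℕ => B R * (2 / ((N : ℝ) + 1))) atTop (nhds 0) := by
    intro R
    have h1 := (tendsto_one_div_add_atTop_nhds_zero_nat (𝕜 := ℝ)).const_mul (B R * 2)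
    rw [mul_zero] at h1
    refine h1.congr fun N => ?_
    ring
  have hmem : ∀ z : ℂ, z ∈ Metric.ball (0 : ℂ) (‖z‖ + 1) := fun z => by simp
  have hex : ∀ z, ∃ y, Tendsto (fun n => u n z) atTop (nhds y) := fun z =>
    cauchySeq_tendsto_of_complete
      (cauchySeq_of_le_tendsto_0 _ (hbd _ z (hmem z)) (hlim _))
  choose F hF using hex
  have hunif : ∀ R, TendstoUniformlyOn u F atTop (Metric.ball 0 R) := by
    intro R
    rw [Metric.tendstoUniformlyOn_iff]
    intro ε hε
    filter_upwards [(hlim R).eventually_lt_const hε] with n hn z hz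
    refine lt_of_le_of_lt ?_ hn
    exact le_of_tendsto ((hF z).dist tendsto_const_nhds)
      (eventually_atTop.2 ⟨n, fun m hm => hbd R z hz m n n hm le_rfl⟩)
  refine ⟨F, fun z => ?_, ?_, fun z => ?_⟩
  · exact ((hunif (‖z‖ + 1)).tendstoLocallyUniformlyOn.differentiableOn
      (Eventually.of_forall fun n => (hdb.1 _ (huL n)).differentiableOn)
      Metric.isOpen_ball).differentiableAt (Metric.isOpen_ball.mem_nhds (hmem z))
  · have h0 : Tendsto (fun n : ℕ => ENNReal.ofReal (1 / ((n : ℝ) + 1))) atTop (nhds 0) := by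
      simpa using ENNReal.tendsto_ofReal (tendsto_one_div_add_atTop_nhds_zero_nat (𝕜 := ℝ))
    have h1 : TendstoInMeasure μ (fun n (x : ℝ) => u n x) atTop f := by
      refine tendstoInMeasure_of_tendsto_eLpNorm one_ne_zero
        (fun n => (hui n).aestronglyMeasurable) hfi.aestronglyMeasurable ?_
      refine tendsto_of_tendsto_of_tendsto_of_le_of_le tendsto_const_nhds h0
        (fun _ => zero_le) fun n => ?_
      rw [← eLpNorm_neg, neg_sub, eLpNorm_one_eq_lintegral_enorm]
      exact (hu n).le
    obtain ⟨ns, hns, hae⟩ := h1.exists_seq_tendsto_ae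
    filter_upwards [hae] with x hx
    exact tendsto_nhds_unique hx ((hF x).comp hns.tendsto_atTop)
  · have hle : ∀ n, (‖u n z‖₊ : ℝ≥0∞) ≤ L1Majorant μ L z *
        ((∫⁻ x : ℝ, (‖f x‖₊ : ℝ≥0∞) ∂μ) + ENNReal.ofReal (1 / ((n : ℝ) + 1))) := by
      intro n
      refine (nnnorm_apply_le_L1Majorant_mul hint hinj (huL n) z).trans ?_
      gcongr
      refine le_trans ?_ (add_le_add le_rfl (hu n).le)
      refine le_trans ?_ (lintegral_add_left' hfi.aestronglyMeasurable.enorm _).le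
      refine lintegral_mono fun x => ?_
      have h1 : u n x = f x - (f x - u n x) := by simp
      nth_rw 1 [h1]
      exact enorm_sub_le
    have htop : L1Majorant μ L z ≠ ⊤ :=
      ((hB _ z (hmem z)).trans_lt ENNReal.ofReal_lt_top).ne
    have h0 : Tendsto (fun n : ℕ => (∫⁻ x : ℝ, (‖f x‖₊ : ℝ≥0∞) ∂μ) +
        ENNReal.ofReal (1 / ((n : ℝ) + 1))) atTop (nhds (∫⁻ x : ℝ, (‖f x‖₊ : ℝ≥0∞) ∂μ)) := by
      simpa using tendsto_const_nhds.add
        (ENNReal.tendsto_ofReal (tendsto_one_div_add_atTop_nhds_zero_nat (𝕜 := ℝ)))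
    exact le_of_tendsto_of_tendsto' (ENNReal.tendsto_coe.2 (hF z).nnnorm)
      (ENNReal.Tendsto.const_mul h0 (Or.inr htop)) hle
end

section
/- Let μ be a positive Borel measure on ℝ and let 𝓛 be an algebraic de Branges space such that ∫_ℝ |F| dμ < ∞ for all F ∈ 𝓛, and such that F ∈ 𝓛 with ∫_ℝ |F| dμ = 0 implies F = 0. Assume 𝓛 (via restriction to ℝ) is not dense in L¹(μ), and let 𝔪(z) := sup{|F(z)| : F ∈ 𝓛, ‖F|_ℝ‖_{L¹(μ)} ≤ 1}. Suppose f, g lie in the closure of 𝓛 in L¹(μ), and F, G are entire functions with F|_ℝ = f and G|_ℝ = g μ-almost everywhere, satisfying |F(z)| ≤ 𝔪(z)‖f‖ and |G(z)| ≤ 𝔪(z)‖g‖ for all z ∈ ℂ, with G not identically zero. Then the meromorphic quotient F/G is of bounded type on both the upper half-plane ℂ⁺ and the lower half-plane ℂ⁻. -/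
open Filter MeasureTheory
open scoped ENNReal NNReal

/-- The open upper half-plane. -/
def UpperHalf : Set ℂ := {z | 0 < z.im}

/-- The open lower half-plane. -/
def LowerHalf : Set ℂ := {z | z.im < 0}

/-- The (possibly meromorphic) quotient `F/G` is of bounded type on `S`:
`F/G = g₁/g₂` with `g₁, g₂` bounded and holomorphic on `S` and `g₂` not
identically zero; the identity `F/G = g₁/g₂` is expressed as `F·g₂ = G·g₁` on `S`. -/
def BddTypeQuot (S : Set ℂ) (F G : ℂ → ℂ) : Prop :=
  ∃ g₁ g₂ : ℂ → ℂ, DifferentiableOn ℂ g₁ S ∧ DifferentiableOn ℂ g₂ S ∧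
    (∃ C : ℝ, ∀ z ∈ S, ‖g₁ z‖ ≤ C) ∧ (∃ C : ℝ, ∀ z ∈ S, ‖g₂ z‖ ≤ C) ∧
    (¬ ∀ z ∈ S, g₂ z = 0) ∧ (∀ z ∈ S, F z * g₂ z = G z * g₁ z)

theorem norm_toL1_eq_integral {α : Type*} [MeasurableSpace α] {μ : Measure α} {k : α → ℂ}
    (hk : Integrable k μ) : ‖hk.toL1 k‖ = ∫ x, ‖k x‖ ∂μ :=
  L1.norm_of_fun_eq_integral_norm hk

/-- Every continuous functional on `L¹` of a σ-finite measure is integration against a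
bounded function. -/
theorem exists_bounded_density {α : Type*} [MeasurableSpace α] (μ : Measure α) [SigmaFinite μ]
    (ℓ : Lp ℂ 1 μ →L[ℂ] ℂ) :
    ∃ φ : α → ℂ, Measurable φ ∧ (∃ C, ∀ x, ‖φ x‖ ≤ C) ∧
      ∀ (k : α → ℂ) (hk : Integrable k μ), ℓ (hk.toL1 k) = ∫ x, φ x * k x ∂μ := by
  obtain ⟨w, wpos, wmeas, wint⟩ := exists_pos_lintegral_lt_of_sigmaFinite μ one_ne_zero
  have hwint : Integrable (fun x => (w x : ℝ)) μ := by
    refine ⟨wmeas.coe_nnreal_real.aestronglyMeasurable, ?_⟩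
    simpa [HasFiniteIntegral] using wint.trans ENNReal.one_lt_top
  set u : α → ℝ := fun x => √(w x) with hu_def
  have hupos : ∀ x, 0 < u x := fun x => Real.sqrt_pos.2 (wpos x)
  have husq : ∀ x, u x * u x = w x := fun x => Real.mul_self_sqrt (w x).2
  have humeas : Measurable u := wmeas.coe_nnreal_real.sqrt
  have hu0 : ∀ x, (u x : ℂ) ≠ 0 := fun x => by exact_mod_cast (hupos x).ne'
  have humeasc : Measurable fun x => (u x : ℂ) := Complex.measurable_ofReal.comp humeas
  have hu2 : MemLp (fun x => (u x : ℂ)) 2 μ := by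
    refine (memLp_two_iff_integrable_sq_norm humeasc.aestronglyMeasurable).2 ?_
    refine hwint.congr (.of_forall fun x => ?_)
    simp [← husq x, sq]
  set T := (ContinuousLinearMap.mul ℂ ℂ).holderL μ 2 2 1 hu2.toLp with hT
  set v := (InnerProductSpace.toDual ℂ (Lp ℂ 2 μ)).symm (ℓ ∘L T) with hv
  have hvmeas : Measurable v := (Lp.stronglyMeasurable v).measurable
  set ψ : α → ℂ := fun x => (starRingEnd ℂ) (v x) / u x with hψ
  have hψmeas : Measurable ψ := (Complex.continuous_conj.measurable.comp hvmeas).div humeasc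
  have key : ∀ (k : α → ℂ) (hk : Integrable k μ), MemLp (fun x => k x / u x) 2 μ →
      ℓ (hk.toL1 k) = ∫ x, ψ x * k x ∂μ := by
    intro k hk hk2
    have h1 : T (hk2.toLp) = hk.toL1 k := by
      refine Lp.ext ?_
      filter_upwards [(ContinuousLinearMap.mul ℂ ℂ).coeFn_holder (r := 1) hu2.toLp hk2.toLp,
        hk.coeFn_toL1, hu2.coeFn_toLp, hk2.coeFn_toLp] with x h1 h2 h3 h4
      rw [h2, hT, ContinuousLinearMap.holderL_apply_apply, h1, h3, h4]
      simp [mul_div_cancel₀ _ (hu0 x)]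
    have h2 : inner ℂ v hk2.toLp = ℓ (T hk2.toLp) := InnerProductSpace.toDual_symm_apply
    rw [← h1, ← h2, L2.inner_def]
    refine integral_congr_ae ?_
    filter_upwards [hk2.coeFn_toLp] with x h4
    rw [h4]
    simp only [RCLike.inner_apply, hψ]
    ring
  have key2 : ∀ (k : α → ℂ) (hk : Integrable k μ) (n : ℝ), (∀ x, ‖k x‖ ≤ n * w x) →
      ℓ (hk.toL1 k) = ∫ x, ψ x * k x ∂μ := by
    intro k hk n hn
    refine key k hk (hu2.of_le_mul (c := n) ?_ (.of_forall fun x => ?_))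
    · exact (hk.1.aemeasurable.div humeasc.aemeasurable).aestronglyMeasurable
    · have := hupos x
      simp only [norm_div, Complex.norm_real, Real.norm_eq_abs, abs_of_pos this]
      rw [div_le_iff₀ this, mul_assoc, husq]
      exact hn x
  have hψw : Integrable (fun x => ‖ψ x‖ * w x) μ := by
    have : Integrable (fun x => ‖v x * (u x : ℂ)‖) μ := ((Lp.memLp v).integrable_mul hu2).norm
    refine this.congr (.of_forall fun x => ?_)
    have := hupos x
    simp only [hψ, norm_mul, norm_div, RCLike.norm_conj, Complex.norm_real, Real.norm_eq_abs,
      abs_of_pos this, ← husq]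
    field_simp
  have hbd : 0 ≤ᵐ[μ] fun x => ‖ℓ‖ * w x - ‖ψ x‖ * w x := by
    have hint := (hwint.const_mul ‖ℓ‖).sub hψw
    refine ae_nonneg_of_forall_setIntegral_nonneg hint ?_
    intro s hs _
    set k : α → ℂ := s.indicator fun x => (w x : ℂ) * ((starRingEnd ℂ) (ψ x) / ‖ψ x‖) with hkdef
    have hkn : ∀ x, ‖k x‖ ≤ s.indicator (fun x => (w x : ℝ)) x := by
      intro x
      rw [hkdef, norm_indicator_eq_indicator_norm]
      refine Set.indicator_le_indicator ?_
      simp only [norm_mul, norm_div, RCLike.norm_conj, Complex.norm_real, norm_norm,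
        Real.norm_of_nonneg (w x).coe_nonneg]
      exact mul_le_of_le_one_right (w x).2 (div_self_le_one _)
    have hkmeas : Measurable k := by
      refine Measurable.indicator ?_ hs
      exact (Complex.measurable_ofReal.comp wmeas.coe_nnreal_real).mul
        ((Complex.continuous_conj.measurable.comp hψmeas).div
          (Complex.measurable_ofReal.comp hψmeas.norm))
    have hk : Integrable k μ :=
      (hwint.indicator hs).mono' hkmeas.aestronglyMeasurable (.of_forall hkn)
    have h1 := key2 k hk 1 fun x => (hkn x).trans <| by
      rw [one_mul]; exact Set.indicator_le_self' (fun _ _ => (w x).2) x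
    have h2 : ∫ x, ψ x * k x ∂μ = ((∫ x in s, ‖ψ x‖ * w x ∂μ : ℝ) : ℂ) := by
      rw [← integral_indicator hs, ← integral_complex_ofReal]
      refine integral_congr_ae (.of_forall fun x => ?_)
      by_cases hx : x ∈ s
      · simp only [hkdef, Set.indicator_of_mem hx]
        by_cases h0 : ψ x = 0
        · simp [h0]
        · have h0' : (‖ψ x‖ : ℂ) ≠ 0 := by simpa using h0
          have := Complex.mul_conj' (ψ x)
          push_cast
          field_simp
          rw [← this]
          ring
      · simp [hkdef, hx]
    have h3 : ‖ℓ (hk.toL1 k)‖ ≤ ‖ℓ‖ * ∫ x in s, (w x : ℝ) ∂μ := by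
      refine (ℓ.le_opNorm _).trans (mul_le_mul_of_nonneg_left ?_ (norm_nonneg _))
      rw [norm_toL1_eq_integral, ← integral_indicator hs]
      exact integral_mono hk.norm (hwint.indicator hs) hkn
    rw [h1, h2, Complex.norm_real] at h3
    have h4 := (le_abs_self _).trans h3
    rw [integral_sub (hwint.const_mul ‖ℓ‖).integrableOn hψw.integrableOn, integral_const_mul]
    linarith
  have hbd' : ∀ᵐ x ∂μ, ‖ψ x‖ ≤ ‖ℓ‖ := by
    filter_upwards [hbd] with x hx
    have hx' : 0 ≤ ‖ℓ‖ * w x - ‖ψ x‖ * w x := hx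
    exact le_of_mul_le_mul_right (by linarith) (show (0 : ℝ) < w x from wpos x)
  set φ : α → ℂ := {x | ‖ψ x‖ ≤ ‖ℓ‖}.indicator ψ with hφ
  have hφmeas : Measurable φ :=
    hψmeas.indicator (measurableSet_le hψmeas.norm measurable_const)
  have hφψ : φ =ᵐ[μ] ψ := by
    filter_upwards [hbd'] with x hx
    exact Set.indicator_of_mem (s := {x | ‖ψ x‖ ≤ ‖ℓ‖}) hx ψ
  have hφb : ∀ x, ‖φ x‖ ≤ ‖ℓ‖ := by
    intro x
    by_cases hx : ‖ψ x‖ ≤ ‖ℓ‖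
    · simp [hφ, hx]
    · simp [hφ, hx]
  refine ⟨φ, hφmeas, ⟨‖ℓ‖, hφb⟩, fun k hk => ?_⟩
  obtain ⟨k', hk'm, hkk'⟩ := hk.1
  have hk'm := hk'm.measurable
  have hk' : Integrable k' μ := hk.congr hkk'
  have e1 : hk.toL1 k = hk'.toL1 k' := (Integrable.toL1_eq_toL1_iff _ _ _ _).2 hkk'
  have e2 : ∫ x, φ x * k x ∂μ = ∫ x, φ x * k' x ∂μ :=
    integral_congr_ae (hkk'.mono fun x hx => by simp only [hx])
  rw [e1, e2]
  set A : ℕ → Set α := fun n => {x | ‖k' x‖ ≤ n * w x} with hA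
  have hAm : ∀ n, MeasurableSet (A n) := fun n =>
    measurableSet_le hk'm.norm (wmeas.coe_nnreal_real.const_mul _)
  have hAev : ∀ x, ∀ᶠ n in atTop, x ∈ A n := by
    intro x
    obtain ⟨N, hN⟩ := exists_nat_ge (‖k' x‖ / w x)
    filter_upwards [eventually_ge_atTop N] with n hn
    have : ‖k' x‖ / w x ≤ n := hN.trans (by exact_mod_cast hn)
    exact (div_le_iff₀ (show (0 : ℝ) < w x from wpos x)).1 this
  have hki : ∀ n, Integrable ((A n).indicator k') μ := fun n => hk'.indicator (hAm n)
  have hpt : ∀ x, Tendsto (fun n => (A n).indicator k' x) atTop (nhds (k' x)) := fun x =>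
    tendsto_const_nhds.congr' <| (hAev x).mono fun n hn => (Set.indicator_of_mem hn k').symm
  have hle : ∀ n x, ‖(A n).indicator k' x‖ ≤ ‖k' x‖ := fun n x => norm_indicator_le_norm_self _ _
  have lim1 : Tendsto (fun n => ℓ ((hki n).toL1 _)) atTop (nhds (ℓ (hk'.toL1 k'))) := by
    refine (ℓ.continuous.tendsto _).comp ?_
    rw [tendsto_iff_norm_sub_tendsto_zero]
    simp_rw [← Integrable.toL1_sub, norm_toL1_eq_integral]
    have : Tendsto (fun n => ∫ x, ‖((A n).indicator k' - k') x‖ ∂μ) atTop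
        (nhds (∫ _, (0 : ℝ) ∂μ)) := by
      refine tendsto_integral_of_dominated_convergence (fun x => ‖k' x‖ + ‖k' x‖)
        (fun n => ((hki n).sub hk').norm.1) (hk'.norm.add hk'.norm) (fun n => .of_forall fun x => ?_)
        (.of_forall fun x => ?_)
      · rw [norm_norm, Pi.sub_apply]
        exact (norm_sub_le _ _).trans (add_le_add_left (hle n x) _)
      · simpa using ((hpt x).sub_const (k' x)).norm
    simpa using this
  have lim2 : Tendsto (fun n => ∫ x, φ x * (A n).indicator k' x ∂μ) atTop
      (nhds (∫ x, φ x * k' x ∂μ)) := by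
    refine tendsto_integral_of_dominated_convergence (fun x => ‖ℓ‖ * ‖k' x‖)
      (fun n => hφmeas.aestronglyMeasurable.mul (hki n).1) (hk'.norm.const_mul _)
      (fun n => .of_forall fun x => ?_) (.of_forall fun x => (hpt x).const_mul _)
    rw [norm_mul]
    exact mul_le_mul (hφb x) (hle n x) (norm_nonneg _) (norm_nonneg _)
  refine tendsto_nhds_unique lim1 (lim2.congr fun n => ?_)
  rw [key2 _ (hki n) n fun x => ?_]
  · exact integral_congr_ae (hφψ.mono fun x hx => by simp only [hx])
  · by_cases hx : x ∈ A n
    · rw [Set.indicator_of_mem hx]; exact hx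
    · rw [Set.indicator_of_notMem hx, norm_zero]
      exact mul_nonneg n.cast_nonneg (w x).2

/-- If `L` is not dense in `L¹(μ)`, some nonzero bounded function annihilates it. -/
theorem exists_annihilator {μ : Measure ℝ} [SigmaFinite μ] {L : Submodule ℂ (ℂ → ℂ)}
    (hL : ∀ H ∈ L, Integrable (fun x : ℝ => H x) μ) (hnd : ¬ DenseL1 μ L) :
    ∃ φ : ℝ → ℂ, Measurable φ ∧ (∃ C, ∀ x, ‖φ x‖ ≤ C) ∧
      (∀ H ∈ L, ∫ x, φ x * H x ∂μ = 0) ∧ ¬ φ =ᵐ[μ] 0 := by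
  simp only [DenseL1, MemClosL1, not_forall, not_and, not_exists] at hnd
  obtain ⟨f, hf, hfar⟩ := hnd
  obtain ⟨ε, hε, hfar⟩ := hfar hf
  let M : Submodule ℂ (Lp ℂ 1 μ) :=
    { carrier := {k | ∃ (H : ℂ → ℂ) (hH : H ∈ L), k = (hL H hH).toL1 _}
      add_mem' := by
        rintro _ _ ⟨H, hH, rfl⟩ ⟨K, hK, rfl⟩
        exact ⟨H + K, L.add_mem hH hK, (Integrable.toL1_add _ _ _ _).symm⟩
      zero_mem' := ⟨0, L.zero_mem, (Integrable.toL1_zero _).symm⟩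
      smul_mem' := by
        rintro c _ ⟨H, hH, rfl⟩
        exact ⟨c • H, L.smul_mem c hH, (Integrable.toL1_smul _ (hL H hH) c).symm⟩ }
  have hfM : hf.toL1 f ∉ M.topologicalClosure := by
    intro h
    rw [← SetLike.mem_coe, Submodule.topologicalClosure_coe, Metric.mem_closure_iff] at h
    obtain ⟨_, ⟨H, hH, rfl⟩, hlt⟩ := h ε hε
    refine hfar H hH ?_
    rw [dist_eq_norm, ← Integrable.toL1_sub, norm_toL1_eq_integral] at hlt
    have hi : Integrable (fun x : ℝ => f x - H x) μ := hf.sub (hL H hH)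
    have := ofReal_integral_norm_eq_lintegral_enorm hi
    simp only [enorm_eq_nnnorm] at this
    rw [← this]
    exact (ENNReal.ofReal_lt_ofReal_iff hε).2 hlt
  have : IsClosed (M.topologicalClosure : Set (Lp ℂ 1 μ)) := M.isClosed_topologicalClosure
  have hq : ‖M.topologicalClosure.mkQ (hf.toL1 f)‖ ≠ 0 := by
    rw [norm_ne_zero_iff, Submodule.mkQ_apply, Ne, Submodule.Quotient.mk_eq_zero]
    exact hfM
  obtain ⟨g, -, hg⟩ := exists_dual_vector ℂ _ hq
  obtain ⟨φ, hφ, hφb, hrep⟩ := exists_bounded_density μ (g ∘L M.topologicalClosure.mkQL)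
  refine ⟨φ, hφ, hφb, fun H hH => ?_, fun h0 => ?_⟩
  · rw [← hrep _ (hL H hH)]
    have : M.topologicalClosure.mkQ ((hL H hH).toL1 _) = 0 := by
      rw [Submodule.mkQ_apply, Submodule.Quotient.mk_eq_zero]
      exact M.le_topologicalClosure ⟨H, hH, rfl⟩
    change g (M.topologicalClosure.mkQ _) = 0
    rw [this, map_zero]
  · have h1 := hrep f hf
    change g (M.topologicalClosure.mkQ _) = _ at h1
    rw [hg, integral_eq_zero_of_ae] at h1
    · exact hq (Complex.ofReal_eq_zero.1 h1)
    · filter_upwards [h0] with x hx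
      simp [hx]

/-- An integral of holomorphic functions with a locally uniform integrable bound is
holomorphic. -/
theorem differentiableOn_integral_of_locally_dominated {α : Type*} [MeasurableSpace α]
    {μ : Measure α} {U : Set ℂ} {k : α → ℂ → ℂ}
    (hm : ∀ w ∈ U, AEStronglyMeasurable (fun x => k x w) μ)
    (hb : ∀ w₀ ∈ U, ∃ r > 0, Metric.ball w₀ r ⊆ U ∧
      (∀ x, DifferentiableOn ℂ (k x) (Metric.ball w₀ r)) ∧
      ∃ b : α → ℝ, Integrable b μ ∧ ∀ x, ∀ w ∈ Metric.ball w₀ r, ‖k x w‖ ≤ b x) :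
    DifferentiableOn ℂ (fun w => ∫ x, k x w ∂μ) U := by
  intro w₀ hw₀
  obtain ⟨r, hr, hrU, hd, b, hbi, hkb⟩ := hb w₀ hw₀
  have hr2 : 0 < r / 2 := half_pos hr
  have hr4 : 0 < r / 4 := by positivity
  have hsub : ∀ w ∈ Metric.ball w₀ (r / 2), Metric.closedBall w (r / 4) ⊆ Metric.ball w₀ r := by
    intro w hw z hz
    rw [Metric.mem_ball] at *
    rw [Metric.mem_closedBall] at hz
    linarith [dist_triangle z w w₀]
  have hnhds : Metric.ball w₀ (r / 2) ∈ nhds w₀ := Metric.ball_mem_nhds _ hr2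
  have hDer : ∀ x, ∀ w ∈ Metric.ball w₀ (r / 2), HasDerivAt (k x) (deriv (k x) w) w := by
    intro x w hw
    exact ((hd x).differentiableAt (Metric.isOpen_ball.mem_nhds
      (Metric.ball_subset_ball (by linarith) hw))).hasDerivAt
  have hball : ∀ w ∈ Metric.ball w₀ (r / 2), w ∈ U := fun w hw =>
    hrU (Metric.ball_subset_ball (by linarith) hw)
  have hw₀' : w₀ ∈ Metric.ball w₀ (r / 2) := Metric.mem_ball_self hr2
  have hint : Integrable (fun x => k x w₀) μ :=
    hbi.mono' (hm w₀ hw₀) (.of_forall fun x => hkb x w₀ (Metric.mem_ball_self hr))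
  have hDmeas : AEStronglyMeasurable (fun x => deriv (k x) w₀) μ := by
    obtain ⟨t, ht0, htlim⟩ : ∃ t : ℕ → ℂ, (∀ n, w₀ + t n ∈ Metric.ball w₀ (r / 2)) ∧
        Tendsto t atTop (nhdsWithin 0 {0}ᶜ) := by
      have : ∀ᶠ n : ℕ in atTop, 1 / ((n : ℝ) + 1) < r / 2 :=
        tendsto_one_div_add_atTop_nhds_zero_nat.eventually (gt_mem_nhds hr2)
      obtain ⟨N, hN⟩ := eventually_atTop.1 this
      refine ⟨fun n => ((1 / (((n + N : ℕ) : ℝ) + 1) : ℝ) : ℂ), fun n => ?_, ?_⟩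
      · rw [Metric.mem_ball, dist_eq_norm, add_sub_cancel_left, Complex.norm_real,
          Real.norm_of_nonneg (by positivity)]
        exact hN _ (by omega)
      · refine tendsto_nhdsWithin_iff.2 ⟨?_, .of_forall fun n => ?_⟩
        · have h1 := (tendsto_add_atTop_iff_nat (f := fun n : ℕ => 1 / ((n : ℝ) + 1)) N).2
            tendsto_one_div_add_atTop_nhds_zero_nat
          have := (Complex.continuous_ofReal.tendsto 0).comp h1
          simpa only [Complex.ofReal_zero] using! this
        · have : (1 / (((n + N : ℕ) : ℝ) + 1) : ℝ) ≠ 0 := by positivity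
          exact Complex.ofReal_ne_zero.2 this
    refine aestronglyMeasurable_of_tendsto_ae atTop
      (f := fun n x => (t n)⁻¹ • (k x (w₀ + t n) - k x w₀)) (fun n => ?_) (.of_forall fun x => ?_)
    · exact ((hm _ (hball _ (ht0 n))).sub (hm _ hw₀)).const_smul (t n)⁻¹
    · exact (hasDerivAt_iff_tendsto_slope_zero.1 (hDer x w₀ hw₀')).comp htlim
  refine (hasDerivAt_integral_of_dominated_loc_of_deriv_le (F := fun w x => k x w)
    (F' := fun w x => deriv (k x) w) hnhds ?_ hint hDmeas
    (bound := fun x => b x / (r / 4)) (.of_forall fun x w hw => ?_) (hbi.div_const _)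
    (.of_forall hDer)).2.differentiableAt.differentiableWithinAt
  · filter_upwards [hnhds] with w hw using hm w (hball w hw)
  · refine Complex.norm_deriv_le_of_forall_mem_sphere_norm_le hr4 ?_ fun z hz =>
      hkb x z (hsub w hw (Metric.sphere_subset_closedBall hz))
    exact DifferentiableOn.diffContOnCl_ball (U := Metric.ball w₀ r) (hd x) (hsub w hw)

/-- The Cauchy transform of the (complex) measure `ρ dμ`. -/
noncomputable def cauchyTransform (μ : Measure ℝ) (ρ : ℝ → ℂ) (w : ℂ) : ℂ :=
  ∫ x : ℝ, ρ x / (x - w) ∂μ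

section cauchyTransform

variable {μ : Measure ℝ} {ρ : ℝ → ℂ}

theorem abs_im_le_norm_ofReal_sub (x : ℝ) (w : ℂ) : |w.im| ≤ ‖(x : ℂ) - w‖ := by
  simpa using Complex.abs_im_le_norm ((x : ℂ) - w)

theorem norm_div_ofReal_sub_le (x : ℝ) {w : ℂ} (hw : w.im ≠ 0) :
    ‖ρ x / ((x : ℂ) - w)‖ ≤ ‖ρ x‖ / |w.im| := by
  rw [norm_div]
  exact div_le_div_of_nonneg_left (norm_nonneg _) (abs_pos.2 hw) (abs_im_le_norm_ofReal_sub x w)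

theorem ofReal_sub_ne_zero (x : ℝ) {w : ℂ} (hw : w.im ≠ 0) : (x : ℂ) - w ≠ 0 := by
  intro h
  have := abs_im_le_norm_ofReal_sub x w
  rw [h, norm_zero] at this
  exact hw (abs_nonpos_iff.1 this)

theorem aestronglyMeasurable_div_ofReal_sub (hρ : Integrable ρ μ) (w : ℂ) :
    AEStronglyMeasurable (fun x : ℝ => ρ x / ((x : ℂ) - w)) μ :=
  (hρ.1.aemeasurable.div
    (Complex.measurable_ofReal.sub_const w).aemeasurable).aestronglyMeasurable

theorem integrable_div_ofReal_sub (hρ : Integrable ρ μ) {w : ℂ} (hw : w.im ≠ 0) :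
    Integrable (fun x : ℝ => ρ x / ((x : ℂ) - w)) μ :=
  (hρ.norm.div_const |w.im|).mono' (aestronglyMeasurable_div_ofReal_sub hρ w)
    (.of_forall fun x => norm_div_ofReal_sub_le x hw)

theorem norm_cauchyTransform_le (hρ : Integrable ρ μ) {w : ℂ} (hw : w.im ≠ 0) :
    ‖cauchyTransform μ ρ w‖ ≤ (∫ x, ‖ρ x‖ ∂μ) / |w.im| := by
  rw [← integral_div]
  exact norm_integral_le_of_norm_le (hρ.norm.div_const _)
    (.of_forall fun x => norm_div_ofReal_sub_le x hw)

theorem differentiableOn_cauchyTransform (hρ : Integrable ρ μ) :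
    DifferentiableOn ℂ (cauchyTransform μ ρ) {w | w.im ≠ 0} := by
  refine differentiableOn_integral_of_locally_dominated
    (fun w _ => aestronglyMeasurable_div_ofReal_sub hρ w) fun w₀ hw₀ => ?_
  have hpos : 0 < |w₀.im| := abs_pos.2 hw₀
  have hlow : ∀ w ∈ Metric.ball w₀ (|w₀.im| / 2), |w₀.im| / 2 ≤ |w.im| := by
    intro w hw
    rw [Metric.mem_ball, dist_eq_norm] at hw
    have h1 := Complex.abs_im_le_norm (w - w₀)
    rw [Complex.sub_im] at h1
    have h2 := abs_sub_abs_le_abs_sub w₀.im w.im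
    rw [abs_sub_comm] at h2
    linarith
  have hne : ∀ w ∈ Metric.ball w₀ (|w₀.im| / 2), w.im ≠ 0 := fun w hw =>
    abs_pos.1 ((half_pos hpos).trans_le (hlow w hw))
  refine ⟨|w₀.im| / 2, half_pos hpos, hne, fun x w hw => ?_,
    fun x => ‖ρ x‖ / (|w₀.im| / 2), hρ.norm.div_const _, fun x w hw => ?_⟩
  · exact ((differentiableAt_const _).div ((differentiableAt_const _).sub differentiableAt_id)
      (ofReal_sub_ne_zero x (hne w hw))).differentiableWithinAt
  · exact (norm_div_ofReal_sub_le x (hne w hw)).trans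
      (div_le_div_of_nonneg_left (norm_nonneg _) (half_pos hpos) (hlow w hw))

theorem cauchyTransform_conj (w : ℂ) :
    cauchyTransform μ (fun x => (starRingEnd ℂ) (ρ x)) w =
      (starRingEnd ℂ) (cauchyTransform μ ρ ((starRingEnd ℂ) w)) := by
  rw [cauchyTransform, cauchyTransform, ← integral_conj]
  simp

end cauchyTransform

/-- An entire function bounded by `A / |Im w|` off the real line vanishes. -/
theorem eq_zero_of_norm_le_div_abs_im {Ψ : ℂ → ℂ} (hΨ : Differentiable ℂ Ψ) {A : ℝ}
    (h : ∀ w : ℂ, w.im ≠ 0 → ‖Ψ w‖ ≤ A / |w.im|) (w : ℂ) : Ψ w = 0 := by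
  have hA : 0 ≤ A := by
    have := (norm_nonneg _).trans (h Complex.I (by simp))
    simpa using this
  have hmax : ∀ R : ℝ, ‖w‖ < R → (R ^ 2 - ‖w‖ ^ 2) * ‖Ψ w‖ ≤ 2 * R * A := by
    intro R hR
    have hR0 : 0 < R := (norm_nonneg w).trans_lt hR
    have hd : Differentiable ℂ fun z => (z ^ 2 - (R : ℂ) ^ 2) * Ψ z := by fun_prop
    have hb : ∀ z ∈ frontier (Metric.ball (0 : ℂ) R),
        ‖(z ^ 2 - (R : ℂ) ^ 2) * Ψ z‖ ≤ 2 * R * A := by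
      intro z hz
      rw [frontier_ball _ hR0.ne', mem_sphere_zero_iff_norm] at hz
      have e : z ^ 2 - (R : ℂ) ^ 2 = z * (z - (starRingEnd ℂ) z) := by
        rw [mul_sub, Complex.mul_conj', hz]; ring
      rw [norm_mul, e, norm_mul, hz, Complex.sub_conj]
      by_cases h0 : z.im = 0
      · simp only [h0, mul_zero, Complex.ofReal_zero, zero_mul, norm_zero]
        positivity
      · have h1 := h z h0
        rw [le_div_iff₀ (abs_pos.2 h0)] at h1
        have e2 : ‖((2 * z.im : ℝ) : ℂ) * Complex.I‖ = 2 * |z.im| := by simp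
        rw [e2]
        nlinarith
    have := Complex.norm_le_of_forall_mem_frontier_norm_le Metric.isBounded_ball
      hd.diffContOnCl hb (subset_closure (mem_ball_zero_iff.2 hR))
    refine le_trans ?_ this
    rw [norm_mul]
    refine mul_le_mul_of_nonneg_right ?_ (norm_nonneg _)
    have h2 := norm_sub_norm_le ((R : ℂ) ^ 2) (w ^ 2)
    rw [norm_sub_rev] at h2
    simpa [abs_of_pos hR0] using h2
  by_contra hne
  have hp : 0 < ‖Ψ w‖ := norm_pos_iff.2 hne
  have hAp : 0 ≤ 2 * A / ‖Ψ w‖ := by positivity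
  have h1 := hmax (‖w‖ + 1 + 2 * A / ‖Ψ w‖) (by linarith)
  have h2 : 2 * A / ‖Ψ w‖ * ‖Ψ w‖ = 2 * A := div_mul_cancel₀ _ hp.ne'
  set q := 2 * A / ‖Ψ w‖ with hq
  have h3 : ((‖w‖ + 1 + q) ^ 2 - ‖w‖ ^ 2) * ‖Ψ w‖
      = (1 + q) * (2 * ‖w‖ + 1 + q) * ‖Ψ w‖ := by ring
  have h4 : (1 + q) * (‖w‖ + 1 + q) * ‖Ψ w‖ ≤ (1 + q) * (2 * ‖w‖ + 1 + q) * ‖Ψ w‖ := by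
    have := norm_nonneg w
    gcongr
    linarith
  have h5 : (1 + q) * (‖w‖ + 1 + q) * ‖Ψ w‖ = (‖w‖ + 1 + q) * (‖Ψ w‖ + 2 * A) := by
    rw [← h2]; ring
  have h6 : 0 < (‖w‖ + 1 + q) * ‖Ψ w‖ := by have := norm_nonneg w; positivity
  nlinarith

/-- The elements of a nonzero algebraic de Branges space have no common zero. -/
theorem IsAlgebraicDeBranges.exists_ne_zero {L : Submodule ℂ (ℂ → ℂ)}
    (hdb : IsAlgebraicDeBranges L) {H : ℂ → ℂ} (hH : H ∈ L) (hH0 : H ≠ 0) (w : ℂ) :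
    ∃ K ∈ L, K w ≠ 0 := by
  have hfin : ∀ n : ℕ, ∀ K ∈ L, analyticOrderAt K w = n → ∃ K ∈ L, K w ≠ 0 := by
    intro n
    induction n with
    | zero =>
      intro K hK hn
      exact ⟨K, hK, ((hdb.1 K hK).analyticAt w).analyticOrderAt_eq_zero.1 (by simpa using hn)⟩
    | succ n ih =>
      intro K hK hn
      by_cases h0 : K w = 0
      · obtain ⟨M, hM, hMK⟩ := hdb.2.1 K hK w h0
        have hfac : K = (fun z => z - w) * M := by
          funext z
          by_cases hz : z = w
          · simp [hz, h0]
          · rw [Pi.mul_apply, hMK z hz, mul_div_cancel₀ _ (sub_ne_zero.2 hz)]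
        have hMa := (hdb.1 M hM).analyticAt w
        have hla : AnalyticAt ℂ (fun z : ℂ => z - w) w := by fun_prop
        have h1 : analyticOrderAt (fun z : ℂ => z - w) w = 1 := by
          refine (hla.analyticOrderAt_eq_natCast (n := 1)).2
            ⟨fun _ => 1, analyticAt_const, one_ne_zero, .of_forall fun z => by simp⟩
        refine ih M hM ?_
        rw [hfac, analyticOrderAt_mul hla hMa, h1, Nat.cast_add, Nat.cast_one, add_comm] at hn
        exact ENat.add_left_injective_of_ne_top ENat.one_ne_top hn
      · exact ⟨K, hK, h0⟩
  by_cases htop : analyticOrderAt H w = ⊤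
  · refine absurd ?_ hH0
    have hHa : AnalyticOnNhd ℂ H Set.univ := fun z _ => (hdb.1 H hH).analyticAt z
    have := hHa.eqOn_zero_of_preconnected_of_eventuallyEq_zero isPreconnected_univ
      (Set.mem_univ w) (analyticOrderAt_eq_top.1 htop)
    exact funext fun z => this (Set.mem_univ z)
  · obtain ⟨n, hn⟩ := ENat.ne_top_iff_exists.1 htop
    exact hfin n H hH hn.symm

theorem cauchyTransform_sub_conj {μ : Measure ℝ} {ρ : ℝ → ℂ} (hρ : Integrable ρ μ) (t : ℝ)
    {y : ℝ} (hy : 0 < y) :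
    cauchyTransform μ ρ (t + y * Complex.I) - cauchyTransform μ ρ (t - y * Complex.I) =
      2 * Complex.I * ∫ x : ℝ, ρ x * ((y / ((x - t) ^ 2 + y ^ 2) : ℝ) : ℂ) ∂μ := by
  have h1 : ((t : ℂ) + y * Complex.I).im ≠ 0 := by simpa using hy.ne'
  have h2 : ((t : ℂ) - y * Complex.I).im ≠ 0 := by simpa using hy.ne'
  rw [cauchyTransform, cauchyTransform, ← integral_sub (integrable_div_ofReal_sub hρ h1)
    (integrable_div_ofReal_sub hρ h2), ← integral_const_mul]
  refine integral_congr_ae (.of_forall fun x => ?_)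
  have h3 := ofReal_sub_ne_zero x h1
  have h4 := ofReal_sub_ne_zero x h2
  have h5 : ((x : ℂ) - t) ^ 2 + (y : ℂ) ^ 2 ≠ 0 := by
    have : (x - t) ^ 2 + y ^ 2 ≠ 0 := by positivity
    exact_mod_cast this
  have h6 : ((x : ℂ) - (t + y * Complex.I)) * (x - (t - y * Complex.I))
      = ((x : ℂ) - t) ^ 2 + (y : ℂ) ^ 2 := by
    ring_nf; rw [Complex.I_sq]; ring
  push_cast
  rw [div_sub_div _ _ h3 h4, h6]
  field_simp
  ring

/-- A finite complex measure `ρ dμ` is determined by its Cauchy transform off the real line. -/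
theorem ae_eq_zero_of_cauchyTransform_eq_zero {μ : Measure ℝ} [SigmaFinite μ] {ρ : ℝ → ℂ}
    (hρ : Integrable ρ μ) (h : ∀ w : ℂ, w.im ≠ 0 → cauchyTransform μ ρ w = 0) :
    ρ =ᵐ[μ] 0 := by
  refine ae_eq_zero_of_integral_contDiff_smul_eq_zero hρ.locallyIntegrable fun g hg hgs => ?_
  have hgc : Continuous g := hg.continuous
  obtain ⟨B, hB⟩ := hgs.exists_bound_of_continuous hgc
  have hgint : Integrable g := hgc.integrable_of_hasCompactSupport hgs
  set J : ℝ → ℝ → ℝ := fun y x => ∫ s, g (x + y * s) * (1 + s ^ 2)⁻¹ with hJ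
  have hJbound : ∀ y x s, ‖g (x + y * s) * (1 + s ^ 2)⁻¹‖ ≤ B * (1 + s ^ 2)⁻¹ := by
    intro y x s
    rw [norm_mul, Real.norm_of_nonneg (by positivity : 0 ≤ (1 + s ^ 2)⁻¹)]
    exact mul_le_mul_of_nonneg_right (hB _) (by positivity)
  have hJlim : ∀ x, Tendsto (fun y => J y x) (nhdsWithin 0 (Set.Ioi 0))
      (nhds (g x * Real.pi)) := by
    intro x
    rw [← integral_univ_inv_one_add_sq, ← integral_const_mul]
    refine tendsto_integral_filter_of_dominated_convergence (fun s => B * (1 + s ^ 2)⁻¹)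
      (.of_forall fun y => ?_) (.of_forall fun y => .of_forall fun s => hJbound y x s)
      (integrable_inv_one_add_sq.const_mul B) (.of_forall fun s => ?_)
    · exact (Continuous.mul (by fun_prop) (Continuous.inv₀ (by fun_prop)
        fun s => by positivity)).aestronglyMeasurable
    · have hc : Continuous fun y => g (x + y * s) * (1 + s ^ 2)⁻¹ := by fun_prop
      have := (hc.tendsto 0).mono_left (nhdsWithin_le_nhds (s := Set.Ioi 0))
      simpa using this
  have hJpoisson : ∀ y, 0 < y → ∀ x, J y x = ∫ t, g t * (y / ((x - t) ^ 2 + y ^ 2)) := by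
    intro y hy x
    rw [← integral_add_left_eq_self _ x]
    have := Measure.integral_comp_mul_left
      (fun t => g (x + t) * (y / ((x - (x + t)) ^ 2 + y ^ 2))) y
    rw [abs_of_pos (inv_pos.2 hy), smul_eq_mul, eq_inv_mul_iff_mul_eq₀ hy.ne'] at this
    rw [← this, ← integral_const_mul]
    refine integral_congr_ae (.of_forall fun s => ?_)
    have : (1 + s ^ 2) ≠ 0 := by positivity
    have h2 : (x - (x + y * s)) ^ 2 + y ^ 2 = y ^ 2 * (1 + s ^ 2) := by ring
    simp only [h2]
    field_simp
  have hzero : ∀ y, 0 < y → ∫ x, ρ x * (J y x : ℂ) ∂μ = 0 := by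
    intro y hy
    have hpoint : ∀ t : ℝ, ∫ x : ℝ, ρ x * ((y / ((x - t) ^ 2 + y ^ 2) : ℝ) : ℂ) ∂μ = 0 := by
      intro t
      have h1 := cauchyTransform_sub_conj hρ t hy
      rw [h _ (by simpa using hy.ne'), h _ (by simpa using hy.ne'), sub_zero] at h1
      simpa using h1.symm
    have hprod : Integrable (Function.uncurry fun (x t : ℝ) =>
        ρ x * ((g t * (y / ((x - t) ^ 2 + y ^ 2)) : ℝ) : ℂ)) (μ.prod volume) := by
      have h1 : Integrable (fun z : ℝ × ℝ => ρ z.1 * (g z.2 : ℂ)) (μ.prod volume) :=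
        hρ.mul_prod hgint.ofReal
      have h2 : Continuous fun z : ℝ × ℝ => ((y / ((z.1 - z.2) ^ 2 + y ^ 2) : ℝ) : ℂ) := by
        refine Complex.continuous_ofReal.comp (Continuous.div (by fun_prop) (by fun_prop) ?_)
        intro z; positivity
      refine (h1.bdd_mul (c := 1 / y) h2.aestronglyMeasurable (.of_forall fun z => ?_)).congr
        (.of_forall fun z => ?_)
      · rw [Complex.norm_real, Real.norm_of_nonneg (by positivity),
          div_le_div_iff₀ (by positivity) hy]
        nlinarith [sq_nonneg (z.1 - z.2)]
      · simp only [Function.uncurry]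
        push_cast
        ring
    calc ∫ x, ρ x * (J y x : ℂ) ∂μ
        = ∫ x, (∫ t, ρ x * ((g t * (y / ((x - t) ^ 2 + y ^ 2)) : ℝ) : ℂ)) ∂μ := by
          refine integral_congr_ae (.of_forall fun x => ?_)
          simp only [hJpoisson y hy x]
          rw [integral_const_mul, integral_complex_ofReal]
      _ = ∫ t, (∫ x, ρ x * ((g t * (y / ((x - t) ^ 2 + y ^ 2)) : ℝ) : ℂ) ∂μ) :=
          integral_integral_swap hprod
      _ = ∫ t, (0 : ℂ) := by
          refine integral_congr_ae (.of_forall fun t => ?_)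
          calc ∫ x, ρ x * ((g t * (y / ((x - t) ^ 2 + y ^ 2)) : ℝ) : ℂ) ∂μ
              = ∫ x, (g t : ℂ) * (ρ x * ((y / ((x - t) ^ 2 + y ^ 2) : ℝ) : ℂ)) ∂μ := by
                refine integral_congr_ae (.of_forall fun x => ?_)
                push_cast
                ring
            _ = 0 := by rw [integral_const_mul, hpoint, mul_zero]
      _ = 0 := integral_zero _ _
  have hlim : Tendsto (fun y => ∫ x, ρ x * (J y x : ℂ) ∂μ) (nhdsWithin 0 (Set.Ioi 0))
      (nhds (∫ x, ρ x * ((g x * Real.pi : ℝ) : ℂ) ∂μ)) := by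
    have hJmeas : ∀ y, StronglyMeasurable (J y) := by
      intro y
      refine StronglyMeasurable.integral_prod_right
        (f := fun x s => g (x + y * s) * (1 + s ^ 2)⁻¹) ?_
      refine Continuous.stronglyMeasurable ?_
      exact Continuous.mul (by fun_prop) (Continuous.inv₀ (by fun_prop) fun s => by positivity)
    refine tendsto_integral_filter_of_dominated_convergence (fun x => ‖ρ x‖ * (B * Real.pi))
      (.of_forall fun y => ?_) (.of_forall fun y => .of_forall fun x => ?_)
      (hρ.norm.mul_const _) (.of_forall fun x => ?_)
    · exact hρ.1.mul
        (Complex.continuous_ofReal.comp_stronglyMeasurable (hJmeas y)).aestronglyMeasurable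
    · rw [norm_mul, Complex.norm_real]
      refine mul_le_mul_of_nonneg_left ?_ (norm_nonneg _)
      rw [← integral_univ_inv_one_add_sq, ← integral_const_mul]
      exact norm_integral_le_of_norm_le (integrable_inv_one_add_sq.const_mul B)
        (.of_forall (hJbound y x))
    · exact ((Complex.continuous_ofReal.tendsto _).comp (hJlim x)).const_mul _
  have hfin : ∫ x, ρ x * ((g x * Real.pi : ℝ) : ℂ) ∂μ = 0 := by
    refine tendsto_nhds_unique hlim (tendsto_const_nhds.congr' ?_)
    filter_upwards [self_mem_nhdsWithin] with y hy using (hzero y hy).symm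
  have hpi : (Real.pi : ℂ) ≠ 0 := Complex.ofReal_ne_zero.2 Real.pi_ne_zero
  have : ∫ x, ρ x * ((g x * Real.pi : ℝ) : ℂ) ∂μ = Real.pi * ∫ x, g x • ρ x ∂μ := by
    rw [← integral_const_mul]
    refine integral_congr_ae (.of_forall fun x => ?_)
    simp only [Complex.real_smul]
    push_cast
    ring
  rw [this] at hfin
  exact (mul_eq_zero.1 hfin).resolve_left hpi

section BoundingFactor

/-- `h` becomes bounded on `S` after multiplication by a bounded zero-free holomorphic
function. -/
def HasBoundingFactor (S : Set ℂ) (h : ℂ → ℂ) : Prop :=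
  ∃ Q : ℂ → ℂ, DifferentiableOn ℂ Q S ∧ (∀ z ∈ S, Q z ≠ 0) ∧ (∃ C : ℝ, ∀ z ∈ S, ‖Q z‖ ≤ C) ∧
    ∃ C : ℝ, ∀ z ∈ S, ‖h z * Q z‖ ≤ C

variable {S : Set ℂ} {h₁ h₂ : ℂ → ℂ}

theorem HasBoundingFactor.add (H₁ : HasBoundingFactor S h₁) (H₂ : HasBoundingFactor S h₂) :
    HasBoundingFactor S (fun z => h₁ z + h₂ z) := by
  obtain ⟨Q₁, d₁, n₁, ⟨C₁, b₁⟩, D₁, e₁⟩ := H₁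
  obtain ⟨Q₂, d₂, n₂, ⟨C₂, b₂⟩, D₂, e₂⟩ := H₂
  refine ⟨fun z => Q₁ z * Q₂ z, d₁.mul d₂, fun z hz => mul_ne_zero (n₁ z hz) (n₂ z hz),
    ⟨C₁ * C₂, fun z hz => ?_⟩, D₁ * C₂ + D₂ * C₁, fun z hz => ?_⟩
  · rw [norm_mul]
    exact mul_le_mul (b₁ z hz) (b₂ z hz) (norm_nonneg _) ((norm_nonneg _).trans (b₁ z hz))
  · have e : (h₁ z + h₂ z) * (Q₁ z * Q₂ z)
        = (h₁ z * Q₁ z) * Q₂ z + (h₂ z * Q₂ z) * Q₁ z := by ring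
    rw [e]
    refine (norm_add_le _ _).trans (add_le_add ?_ ?_)
    · rw [norm_mul]
      exact mul_le_mul (e₁ z hz) (b₂ z hz) (norm_nonneg _) ((norm_nonneg _).trans (e₁ z hz))
    · rw [norm_mul]
      exact mul_le_mul (e₂ z hz) (b₁ z hz) (norm_nonneg _) ((norm_nonneg _).trans (e₂ z hz))

theorem HasBoundingFactor.const_mul (H : HasBoundingFactor S h₁) (c : ℂ) :
    HasBoundingFactor S (fun z => c * h₁ z) := by
  obtain ⟨Q, d, n, b, D, e⟩ := H
  refine ⟨Q, d, n, b, ‖c‖ * D, fun z hz => ?_⟩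
  rw [mul_assoc, norm_mul]
  exact mul_le_mul_of_nonneg_left (e z hz) (norm_nonneg _)

theorem HasBoundingFactor.congr (H : HasBoundingFactor S h₁) (h : ∀ z ∈ S, h₂ z = h₁ z) :
    HasBoundingFactor S h₂ := by
  obtain ⟨Q, d, n, b, D, e⟩ := H
  exact ⟨Q, d, n, b, D, fun z hz => by rw [h z hz]; exact e z hz⟩

variable {μ : Measure ℝ} {σ : ℝ}

theorem cauchyTransform_add {ρ₁ ρ₂ : ℝ → ℂ} (h₁ : Integrable ρ₁ μ) (h₂ : Integrable ρ₂ μ)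
    {w : ℂ} (hw : w.im ≠ 0) :
    cauchyTransform μ (fun x => ρ₁ x + ρ₂ x) w =
      cauchyTransform μ ρ₁ w + cauchyTransform μ ρ₂ w := by
  simp only [cauchyTransform]
  rw [← integral_add (integrable_div_ofReal_sub h₁ hw) (integrable_div_ofReal_sub h₂ hw)]
  simp only [add_div]

theorem cauchyTransform_const_mul (c : ℂ) (ρ : ℝ → ℂ) (w : ℂ) :
    cauchyTransform μ (fun x => c * ρ x) w = c * cauchyTransform μ ρ w := by
  simp only [cauchyTransform]
  rw [← integral_const_mul]
  simp only [mul_div_assoc]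

theorem im_ne_zero_of_pos_mul {z : ℂ} (hz : 0 < σ * z.im) : z.im ≠ 0 := by
  rintro h
  simp [h] at hz

theorem hasBoundingFactor_cauchyTransform_of_nonneg (hσ : σ * σ = 1) {p : ℝ → ℝ}
    (hp : Integrable p μ) (hp0 : ∀ x, 0 ≤ p x) :
    HasBoundingFactor {z | 0 < σ * z.im} (cauchyTransform μ fun x => (p x : ℂ)) := by
  set c := cauchyTransform μ fun x => (p x : ℂ) with hc
  have hpc : Integrable (fun x => (p x : ℂ)) μ := hp.ofReal
  have hσ1 : |σ| = 1 := by
    rw [← abs_mul_abs_self] at hσ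
    nlinarith [abs_nonneg σ]
  have him : ∀ z : ℂ, 0 < σ * z.im → 0 ≤ σ * (c z).im := by
    intro z hz
    have hi := integrable_div_ofReal_sub hpc (im_ne_zero_of_pos_mul hz)
    have h1 : (c z).im = ∫ x : ℝ, ((p x : ℂ) / (x - z)).im ∂μ := (integral_im hi).symm
    rw [h1, ← integral_const_mul]
    refine integral_nonneg fun x => ?_
    have h2 : ((p x : ℂ) / (x - z)).im = p x * z.im / Complex.normSq (x - z) := by
      rw [Complex.div_im]
      simp
      ring
    have h3 : σ * ((p x : ℂ) / (x - z)).im = p x * (σ * z.im) / Complex.normSq (x - z) := by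
      rw [h2]; ring
    change 0 ≤ σ * ((p x : ℂ) / (x - z)).im
    rw [h3]
    exact div_nonneg (mul_nonneg (hp0 x) hz.le) (Complex.normSq_nonneg _)
  have hlow : ∀ z : ℂ, 0 < σ * z.im → 1 ≤ ‖c z + σ * Complex.I‖ := by
    intro z hz
    have h1 := Complex.abs_im_le_norm (c z + σ * Complex.I)
    have h2 : (c z + σ * Complex.I).im = (c z).im + σ := by simp
    have h3 : |σ * ((c z).im + σ)| = |(c z).im + σ| := by rw [abs_mul, hσ1, one_mul]
    have h4 := le_abs_self (σ * ((c z).im + σ))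
    have := him z hz
    rw [h2] at h1
    nlinarith
  have hne : ∀ z : ℂ, 0 < σ * z.im → c z + σ * Complex.I ≠ 0 := fun z hz =>
    norm_pos_iff.1 (one_pos.trans_le (hlow z hz))
  have hQ : ∀ z : ℂ, 0 < σ * z.im → ‖(c z + σ * Complex.I)⁻¹‖ ≤ 1 := fun z hz => by
    rw [norm_inv]
    exact inv_le_one_of_one_le₀ (hlow z hz)
  refine ⟨fun z => (c z + σ * Complex.I)⁻¹, ?_, fun z hz => inv_ne_zero (hne z hz),
    ⟨1, hQ⟩, 2, fun z hz => ?_⟩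
  · refine DifferentiableOn.inv (DifferentiableOn.add_const _ ?_) hne
    exact (differentiableOn_cauchyTransform hpc).mono fun z hz => im_ne_zero_of_pos_mul hz
  · have e : c z * (c z + σ * Complex.I)⁻¹ = 1 - σ * Complex.I * (c z + σ * Complex.I)⁻¹ := by
      have := hne z hz
      field_simp
      ring
    rw [e]
    refine (norm_sub_le _ _).trans ?_
    rw [norm_mul, norm_mul, Complex.norm_I, Complex.norm_real, Real.norm_eq_abs, hσ1, norm_one]
    linarith [hQ z hz]

theorem hasBoundingFactor_cauchyTransform_ofReal (hσ : σ * σ = 1) {p : ℝ → ℝ}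
    (hp : Integrable p μ) :
    HasBoundingFactor {z | 0 < σ * z.im} (cauchyTransform μ fun x => (p x : ℂ)) := by
  have h1 : Integrable (fun x => max (p x) 0) μ := hp.pos_part
  have h2 : Integrable (fun x => max (-p x) 0) μ := hp.neg_part
  have h1c : Integrable (fun x => ((max (p x) 0 : ℝ) : ℂ)) μ := h1.ofReal
  have h2c : Integrable (fun x => (-1 : ℂ) * ((max (-p x) 0 : ℝ) : ℂ)) μ :=
    h2.ofReal.const_mul _
  refine ((hasBoundingFactor_cauchyTransform_of_nonneg hσ h1 fun x => le_max_right _ _).add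
    ((hasBoundingFactor_cauchyTransform_of_nonneg hσ h2 fun x => le_max_right _ _).const_mul
      (-1))).congr fun z hz => ?_
  rw [← cauchyTransform_const_mul, ← cauchyTransform_add h1c h2c
    (im_ne_zero_of_pos_mul hz)]
  congr 1
  funext x
  have := max_zero_sub_max_neg_zero_eq_self (p x)
  rw [neg_one_mul, ← sub_eq_add_neg, ← Complex.ofReal_sub, this]

/-- The Cauchy transform of a finite complex measure is of bounded type in either half-plane. -/
theorem hasBoundingFactor_cauchyTransform (hσ : σ * σ = 1) {ρ : ℝ → ℂ} (hρ : Integrable ρ μ) :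
    HasBoundingFactor {z | 0 < σ * z.im} (cauchyTransform μ ρ) := by
  have hre : Integrable (fun x => (ρ x).re) μ := hρ.re
  have him : Integrable (fun x => (ρ x).im) μ := hρ.im
  have hrec : Integrable (fun x => ((ρ x).re : ℂ)) μ := hre.ofReal
  have himc : Integrable (fun x => Complex.I * ((ρ x).im : ℂ)) μ := him.ofReal.const_mul _
  refine ((hasBoundingFactor_cauchyTransform_ofReal hσ hre).add
    ((hasBoundingFactor_cauchyTransform_ofReal hσ him).const_mul
      Complex.I)).congr fun z hz => ?_
  rw [← cauchyTransform_const_mul, ← cauchyTransform_add hrec himc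
    (im_ne_zero_of_pos_mul hz)]
  congr 1
  funext x
  rw [mul_comm]
  exact (Complex.re_add_im (ρ x)).symm

end BoundingFactor

section Kernel

theorem dslope_symm (F : ℂ → ℂ) (a b : ℂ) : dslope F a b = dslope F b a := by
  rcases eq_or_ne a b with rfl | h
  · rfl
  · rw [dslope_of_ne _ h.symm, dslope_of_ne _ h, slope_comm]

theorem differentiable_dslope {F : ℂ → ℂ} (hF : Differentiable ℂ F) (a : ℂ) :
    Differentiable ℂ (dslope F a) :=
  differentiableOn_univ.1
    ((Complex.differentiableOn_dslope univ_mem).2 hF.differentiableOn)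

variable {μ : Measure ℝ} {φ : ℝ → ℂ}

/-- The integrand `φ(x) (F(w) H(x) - H(w) F(x)) / (w - x)`, with its removable singularity
removed. -/
noncomputable def quotientKernel (φ : ℝ → ℂ) (F H : ℂ → ℂ) (x : ℝ) (w : ℂ) : ℂ :=
  φ x * (dslope F x w * H x - dslope H x w * F x)

theorem sub_mul_quotientKernel (φ : ℝ → ℂ) (F H : ℂ → ℂ) (x : ℝ) (w : ℂ) :
    (w - x) * quotientKernel φ F H x w = φ x * (F w * H x - H w * F x) := by
  have h1 := sub_smul_dslope F x w
  have h2 := sub_smul_dslope H x w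
  rw [smul_eq_mul] at h1 h2
  have : (w - x) * quotientKernel φ F H x w =
      φ x * ((w - x) * dslope F x w * H x - (w - x) * dslope H x w * F x) := by
    rw [quotientKernel]; ring
  rw [this, h1, h2]
  ring

theorem differentiable_quotientKernel {F H : ℂ → ℂ} (hF : Differentiable ℂ F)
    (hH : Differentiable ℂ H) (x : ℝ) : Differentiable ℂ (quotientKernel φ F H x) :=
  (((differentiable_dslope hF x).mul_const _).sub
    ((differentiable_dslope hH x).mul_const _)).const_mul _

theorem aestronglyMeasurable_quotientKernel (hφ : Measurable φ) {F H : ℂ → ℂ}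
    (hF : Differentiable ℂ F) (hH : Differentiable ℂ H) (w : ℂ) :
    AEStronglyMeasurable (fun x => quotientKernel φ F H x w) μ := by
  have h1 := (differentiable_dslope hF w).continuous
  have h2 := (differentiable_dslope hH w).continuous
  have h3 := hF.continuous
  have h4 := hH.continuous
  simp only [quotientKernel, dslope_symm _ _ w]
  refine hφ.aestronglyMeasurable.mul (Continuous.aestronglyMeasurable ?_)
  fun_prop

theorem norm_quotientKernel_le {F H : ℂ → ℂ} (hF : Differentiable ℂ F)
    (hH : Differentiable ℂ H) {C M : ℝ} (hC : ∀ x, ‖φ x‖ ≤ C) {w₀ : ℂ}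
    (hFM : ∀ z ∈ Metric.closedBall w₀ 4, ‖F z‖ ≤ M)
    (hHM : ∀ z ∈ Metric.closedBall w₀ 4, ‖H z‖ ≤ M) (x : ℝ) {w : ℂ}
    (hw : w ∈ Metric.ball w₀ 1) :
    ‖quotientKernel φ F H x w‖ ≤ C * (M * (‖H x‖ + ‖F x‖)) := by
  have hfar : ∀ z ∈ Metric.closedBall w₀ 4, 1 ≤ ‖z - x‖ →
      ‖quotientKernel φ F H x z‖ ≤ C * (M * (‖H x‖ + ‖F x‖)) := by
    intro z hz hzx
    have h1 : ‖quotientKernel φ F H x z‖ ≤ ‖(z - x) * quotientKernel φ F H x z‖ := by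
      rw [norm_mul]
      exact le_mul_of_one_le_left (norm_nonneg _) hzx
    refine h1.trans ?_
    rw [sub_mul_quotientKernel, norm_mul]
    refine mul_le_mul (hC x) ?_ (norm_nonneg _) ((norm_nonneg _).trans (hC x))
    refine (norm_sub_le _ _).trans ?_
    rw [norm_mul, norm_mul, mul_add]
    exact add_le_add (mul_le_mul_of_nonneg_right (hFM z hz) (norm_nonneg _))
      (mul_le_mul_of_nonneg_right (hHM z hz) (norm_nonneg _))
  rcases le_or_gt 2 (dist (x : ℂ) w₀) with hx | hx
  · refine hfar w (Metric.closedBall_subset_closedBall (by norm_num)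
      (Metric.ball_subset_closedBall hw)) ?_
    rw [← dist_eq_norm]
    have := dist_triangle_left (x : ℂ) w₀ w
    have := Metric.mem_ball.1 hw
    linarith
  · refine Complex.norm_le_of_forall_mem_frontier_norm_le (U := Metric.ball w₀ 4)
      Metric.isBounded_ball (differentiable_quotientKernel hF hH x).diffContOnCl ?_
      (subset_closure (Metric.ball_subset_ball (by norm_num) hw))
    intro z hz
    rw [frontier_ball _ (by norm_num)] at hz
    refine hfar z (Metric.sphere_subset_closedBall hz) ?_
    rw [← dist_eq_norm]
    have h1 := dist_triangle z x w₀
    have := Metric.mem_sphere.1 hz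
    linarith

/-- The integral of `quotientKernel` is entire. -/
theorem differentiable_integral_quotientKernel (hφ : Measurable φ) {C : ℝ}
    (hC : ∀ x, ‖φ x‖ ≤ C) {F H : ℂ → ℂ} (hF : Differentiable ℂ F) (hH : Differentiable ℂ H)
    (hFi : Integrable (fun x : ℝ => F x) μ) (hHi : Integrable (fun x : ℝ => H x) μ) :
    Differentiable ℂ fun w => ∫ x, quotientKernel φ F H x w ∂μ := by
  rw [← differentiableOn_univ]
  refine differentiableOn_integral_of_locally_dominated
    (fun w _ => aestronglyMeasurable_quotientKernel hφ hF hH w) fun w₀ _ => ?_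
  obtain ⟨M₁, h₁⟩ := (isCompact_closedBall w₀ 4).exists_bound_of_continuousOn
    hF.continuous.continuousOn
  obtain ⟨M₂, h₂⟩ := (isCompact_closedBall w₀ 4).exists_bound_of_continuousOn
    hH.continuous.continuousOn
  exact ⟨1, one_pos, Set.subset_univ _,
    fun x => (differentiable_quotientKernel hF hH x).differentiableOn,
    fun x => C * (max M₁ M₂ * (‖H x‖ + ‖F x‖)),
    ((hHi.norm.add hFi.norm).const_mul _).const_mul _,
    fun x w hw => norm_quotientKernel_le hF hH hC
      (fun z hz => (h₁ z hz).trans (le_max_left _ _))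
      (fun z hz => (h₂ z hz).trans (le_max_right _ _)) x hw⟩

theorem integrable_bdd_mul (hφ : Measurable φ) {C : ℝ} (hC : ∀ x, ‖φ x‖ ≤ C) {u : ℝ → ℂ}
    (hu : Integrable u μ) : Integrable (fun x => φ x * u x) μ :=
  hu.bdd_mul hφ.aestronglyMeasurable (.of_forall hC)

theorem integral_quotientKernel (hφ : Measurable φ) {C : ℝ}
    (hC : ∀ x, ‖φ x‖ ≤ C) {F H : ℂ → ℂ}
    (hFi : Integrable (fun x : ℝ => F x) μ) (hHi : Integrable (fun x : ℝ => H x) μ)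
    {w : ℂ} (hw : w.im ≠ 0) :
    ∫ x, quotientKernel φ F H x w ∂μ =
      H w * cauchyTransform μ (fun x => φ x * F x) w -
        F w * cauchyTransform μ (fun x => φ x * H x) w := by
  simp only [cauchyTransform]
  rw [← integral_const_mul, ← integral_const_mul, ← integral_sub
    ((integrable_div_ofReal_sub (integrable_bdd_mul hφ hC hFi) hw).const_mul _)
    ((integrable_div_ofReal_sub (integrable_bdd_mul hφ hC hHi) hw).const_mul _)]
  refine integral_congr_ae (.of_forall fun x => ?_)
  have h1 := ofReal_sub_ne_zero x hw
  have h2 := sub_mul_quotientKernel φ F H x w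
  have h3 : w - x ≠ 0 := by rw [← neg_sub]; exact neg_ne_zero.2 h1
  simp only
  rw [← mul_right_inj' h3, h2]
  field_simp
  ring

variable {L : Submodule ℂ (ℂ → ℂ)}

theorem mul_cauchyTransform_comm_of_annihilator (hdb : IsAlgebraicDeBranges L)
    (hL : ∀ H ∈ L, Integrable (fun x : ℝ => H x) μ)
    (hφ : Measurable φ) {C : ℝ} (hC : ∀ x, ‖φ x‖ ≤ C)
    (hann : ∀ H ∈ L, ∫ x : ℝ, φ x * H x ∂μ = 0) {H K : ℂ → ℂ} (hH : H ∈ L) (hK : K ∈ L)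
    {w : ℂ} (hw : w.im ≠ 0) :
    K w * cauchyTransform μ (fun x => φ x * H x) w =
      H w * cauchyTransform μ (fun x => φ x * K x) w := by
  have hmem : K w • H - H w • K ∈ L := L.sub_mem (L.smul_mem _ hH) (L.smul_mem _ hK)
  obtain ⟨D, hD, hDeq⟩ := hdb.2.1 _ hmem w (by simp [mul_comm])
  have h0 := hann D hD
  have h1 : ∀ x : ℝ, φ x * D x = K w * (φ x * H x / (x - w)) - H w * (φ x * K x / (x - w)) := by
    intro x
    have h2 := ofReal_sub_ne_zero x hw
    rw [hDeq x (sub_ne_zero.1 h2)]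
    simp only [Pi.sub_apply, Pi.smul_apply, smul_eq_mul]
    ring
  simp only [h1] at h0
  rw [integral_sub
    ((integrable_div_ofReal_sub (integrable_bdd_mul hφ hC (hL H hH)) hw).const_mul _)
    ((integrable_div_ofReal_sub (integrable_bdd_mul hφ hC (hL K hK)) hw).const_mul _),
    integral_const_mul, integral_const_mul] at h0
  exact sub_eq_zero.1 h0

theorem dense_im_ne_zero : Dense {w : ℂ | w.im ≠ 0} := by
  have h : Dense ({0}ᶜ : Set ℝ) := dense_compl_singleton 0
  exact h.preimage Complex.isOpenMap_im

/-- A function dominated by the `L¹`-majorant of `L` has the same quotients with its Cauchy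
transforms as the elements of `L`. -/
theorem mul_cauchyTransform_comm_of_le_majorant (hdb : IsAlgebraicDeBranges L)
    (hL : ∀ H ∈ L, Integrable (fun x : ℝ => H x) μ)
    (hφ : Measurable φ) {C : ℝ} (hC : ∀ x, ‖φ x‖ ≤ C)
    (hann : ∀ H ∈ L, ∫ x : ℝ, φ x * H x ∂μ = 0) {F : ℂ → ℂ} (hF : Differentiable ℂ F)
    (hFi : Integrable (fun x : ℝ => F x) μ)
    (hFm : ∀ z : ℂ, (‖F z‖₊ : ℝ≥0∞) ≤
      L1Majorant μ L z * ∫⁻ x : ℝ, (‖F (x : ℂ)‖₊ : ℝ≥0∞) ∂μ)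
    {K : ℂ → ℂ} (hK : K ∈ L) {w : ℂ} (hw : w.im ≠ 0) :
    F w * cauchyTransform μ (fun x => φ x * K x) w =
      K w * cauchyTransform μ (fun x => φ x * F x) w := by
  set c : (ℂ → ℂ) → ℂ → ℂ := fun H => cauchyTransform μ fun x => φ x * H x with hc
  set N : (ℂ → ℂ) → ℂ → ℂ := fun H z => ∫ x, quotientKernel φ F H x z ∂μ with hN
  have hN' : ∀ H ∈ L, ∀ z : ℂ, z.im ≠ 0 → N H z = H z * c F z - F z * c H z :=
    fun H hH z hz => integral_quotientKernel hφ hC hFi (hL H hH) hz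
  have hNd : ∀ H ∈ L, Differentiable ℂ (N H) := fun H hH =>
    differentiable_integral_quotientKernel hφ hC hF (hdb.1 H hH) hFi (hL H hH)
  have hcomm : ∀ H ∈ L, ∀ H' ∈ L, ∀ z : ℂ, H' z * N H z = H z * N H' z := by
    intro H hH H' hH' z
    refine congrFun (Continuous.ext_on dense_im_ne_zero
      ((hdb.1 H' hH').continuous.mul (hNd H hH).continuous)
      ((hdb.1 H hH).continuous.mul (hNd H' hH').continuous) fun z hz => ?_) z
    have := mul_cauchyTransform_comm_of_annihilator hdb hL hφ hC hann hH hH' hz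
    change H' z * N H z = H z * N H' z
    rw [hN' H hH z hz, hN' H' hH' z hz]
    linear_combination (-F z) * this
  by_cases hK0 : K = 0
  · simp [hK0, cauchyTransform]
  choose B hB hBne using hdb.exists_ne_zero hK hK0
  set Ψ : ℂ → ℂ := fun z => N (B z) z / B z z with hΨ
  have hΨeq : ∀ H ∈ L, ∀ z, H z ≠ 0 → Ψ z = N H z / H z := by
    intro H hH z hz
    rw [hΨ, div_eq_div_iff (hBne z) hz]
    linear_combination hcomm (B z) (hB z) H hH z
  have hΨd : Differentiable ℂ Ψ := by
    intro z
    have h1 : DifferentiableAt ℂ (fun z' => N (B z) z' / B z z') z :=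
      (hNd _ (hB z) z).div (hdb.1 _ (hB z) z) (hBne z)
    refine h1.congr_of_eventuallyEq ?_
    filter_upwards [(hdb.1 _ (hB z)).continuous.continuousAt.eventually_ne (hBne z)] with z' hz'
    exact hΨeq _ (hB z) z' hz'
  have hC0 : 0 ≤ C := (norm_nonneg _).trans (hC 0)
  have hcle : ∀ H : ℂ → ℂ, Integrable (fun x : ℝ => H x) μ → ∀ z : ℂ, z.im ≠ 0 →
      ‖c H z‖ ≤ C * (∫ x : ℝ, ‖H x‖ ∂μ) / |z.im| := by
    intro H hH z hz
    refine (norm_cauchyTransform_le (integrable_bdd_mul hφ hC hH) hz).trans ?_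
    gcongr
    rw [← integral_const_mul]
    refine integral_mono (integrable_bdd_mul hφ hC hH).norm (hH.norm.const_mul _) fun x => ?_
    simp only [norm_mul]
    exact mul_le_mul_of_nonneg_right (hC x) (norm_nonneg _)
  have hlint : ∀ H : ℂ → ℂ, Integrable (fun x : ℝ => H x) μ →
      ∫⁻ x : ℝ, (‖H (x : ℂ)‖₊ : ℝ≥0∞) ∂μ = ENNReal.ofReal (∫ x : ℝ, ‖H x‖ ∂μ) := fun H hH =>
    (ofReal_integral_norm_eq_lintegral_enorm hH).symm
  have hmaj : ∀ H ∈ L, ∀ z : ℂ, z.im ≠ 0 →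
      L1Majorant μ L z * ENNReal.ofReal ‖c H z‖ ≤ ENNReal.ofReal (‖H z‖ * (C / |z.im|)) := by
    intro H hH z hz
    rw [L1Majorant, ENNReal.iSup_mul]
    refine iSup_le fun ⟨E, hE, hE1⟩ => ?_
    rw [hlint E (hL E hE)] at hE1
    have hE1 : ∫ x : ℝ, ‖E x‖ ∂μ ≤ 1 := by simpa using hE1
    have e : (‖E z‖₊ : ℝ≥0∞) = ENNReal.ofReal ‖E z‖ := (ofReal_norm _).symm
    rw [e, ← ENNReal.ofReal_mul (norm_nonneg _)]
    refine ENNReal.ofReal_le_ofReal ?_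
    rw [← norm_mul, ← mul_cauchyTransform_comm_of_annihilator hdb hL hφ hC hann hE hH hz,
      norm_mul]
    refine mul_le_mul_of_nonneg_left ((hcle E (hL E hE) z hz).trans ?_) (norm_nonneg _)
    gcongr
    exact mul_le_of_le_one_right hC0 hE1
  set I : ℝ := ∫ x : ℝ, ‖F x‖ ∂μ with hI
  have hI0 : 0 ≤ I := integral_nonneg fun _ => norm_nonneg _
  have hFc : ∀ H ∈ L, ∀ z : ℂ, z.im ≠ 0 → ‖F z‖ * ‖c H z‖ ≤ ‖H z‖ * (C * I / |z.im|) := by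
    intro H hH z hz
    have h1 : ENNReal.ofReal (‖F z‖ * ‖c H z‖) ≤
        ENNReal.ofReal (‖H z‖ * (C / |z.im|) * I) := by
      have e : ENNReal.ofReal ‖F z‖ = (‖F z‖₊ : ℝ≥0∞) := ofReal_norm _
      rw [ENNReal.ofReal_mul (norm_nonneg _), e]
      refine (mul_le_mul_left (hFm z) _).trans ?_
      rw [hlint F hFi, mul_right_comm, ENNReal.ofReal_mul (by positivity)]
      exact mul_le_mul_left (hmaj H hH z hz) _
    rw [ENNReal.ofReal_le_ofReal_iff (by positivity)] at h1
    refine h1.trans_eq ?_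
    ring
  have hΨb : ∀ z : ℂ, z.im ≠ 0 → ‖Ψ z‖ ≤ 2 * (C * I) / |z.im| := by
    intro z hz
    have hp : 0 < ‖B z z‖ := norm_pos_iff.2 (hBne z)
    rw [hΨ, norm_div, div_le_iff₀ hp, hN' _ (hB z) z hz]
    refine (norm_sub_le _ _).trans ?_
    rw [norm_mul, norm_mul]
    have h1 := hFc _ (hB z) z hz
    have h2 := mul_le_mul_of_nonneg_left (hcle F hFi z hz) hp.le
    calc _ ≤ ‖B z z‖ * (C * I / |z.im|) + ‖B z z‖ * (C * I / |z.im|) := add_le_add h2 h1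
      _ = _ := by ring
  have hΨ0 : Ψ w = 0 := eq_zero_of_norm_le_div_abs_im hΨd hΨb w
  have hNB : N (B w) w = 0 := (div_eq_zero_iff.1 hΨ0).resolve_right (hBne w)
  have hNK : N K w = 0 := by
    have := hcomm (B w) (hB w) K hK w
    rw [hNB, mul_zero] at this
    exact (mul_eq_zero.1 this.symm).resolve_left (hBne w)
  rw [hN' K hK w hw] at hNK
  exact (sub_eq_zero.1 hNK).symm

end Kernel

section HalfPlane

variable {σ : ℝ}

theorem isOpen_halfPlane (σ : ℝ) : IsOpen {z : ℂ | 0 < σ * z.im} :=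
  isOpen_lt continuous_const (continuous_const.mul Complex.continuous_im)

theorem isPreconnected_halfPlane (σ : ℝ) : IsPreconnected {z : ℂ | 0 < σ * z.im} :=
  (convex_halfSpace_gt (σ • Complex.imLm).isLinear 0).isPreconnected

variable {μ : Measure ℝ} {φ : ℝ → ℂ} {L : Submodule ℂ (ℂ → ℂ)}

theorem ae_eq_zero_of_forall_mul_eq_zero (hdb : IsAlgebraicDeBranges L) {H : ℂ → ℂ}
    (hH : H ∈ L) (hH0 : H ≠ 0) (h : ∀ K ∈ L, (fun x : ℝ => φ x * K x) =ᵐ[μ] 0) :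
    φ =ᵐ[μ] 0 := by
  refine measure_null_of_locally_null _ fun t _ => ?_
  obtain ⟨K, hK, hKt⟩ := hdb.exists_ne_zero hH hH0 (t : ℂ)
  have hKc : Continuous fun x : ℝ => K x := (hdb.1 K hK).continuous.comp Complex.continuous_ofReal
  have hn : {x : ℝ | K x ≠ 0} ∈ nhds t := hKc.continuousAt.eventually_ne hKt
  refine ⟨_, inter_mem_nhdsWithin _ hn, measure_mono_null ?_ (h K hK)⟩
  rintro x ⟨hx1, hx2⟩
  exact mul_ne_zero hx1 hx2

theorem integral_conj_mul_eq_zero (hdb : IsAlgebraicDeBranges L)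
    (hann : ∀ H ∈ L, ∫ x : ℝ, φ x * H x ∂μ = 0) :
    ∀ H ∈ L, ∫ x : ℝ, (starRingEnd ℂ) (φ x) * H x ∂μ = 0 := by
  intro H hH
  have h := congrArg (starRingEnd ℂ) (hann _ (hdb.2.2 H hH))
  rw [← integral_conj] at h
  simpa using h

/-- A non-dense algebraic de Branges space has, for either half-plane, a bounded annihilator
whose Cauchy transform against some element of the space does not vanish identically there. -/
theorem exists_annihilator_cauchyTransform_ne_zero [SigmaFinite μ]
    (hdb : IsAlgebraicDeBranges L) (hL : ∀ H ∈ L, Integrable (fun x : ℝ => H x) μ)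
    (hnd : ¬ DenseL1 μ L) {H : ℂ → ℂ} (hH : H ∈ L) (hH0 : H ≠ 0) (hσ : σ * σ = 1) :
    ∃ φ : ℝ → ℂ, Measurable φ ∧ (∃ C, ∀ x, ‖φ x‖ ≤ C) ∧
      (∀ H ∈ L, ∫ x : ℝ, φ x * H x ∂μ = 0) ∧
      ∃ K ∈ L, ∃ z : ℂ, 0 < σ * z.im ∧ cauchyTransform μ (fun x => φ x * K x) z ≠ 0 := by
  obtain ⟨φ, hφ, ⟨C, hC⟩, hann, hne⟩ := exists_annihilator hL hnd
  by_contra! hcon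
  have h1 := hcon φ hφ ⟨C, hC⟩ hann
  have h2 := hcon (fun x => (starRingEnd ℂ) (φ x)) (by fun_prop)
    ⟨C, fun x => by simpa using hC x⟩ (integral_conj_mul_eq_zero hdb hann)
  refine hne (ae_eq_zero_of_forall_mul_eq_zero hdb hH hH0 fun K hK =>
    ae_eq_zero_of_cauchyTransform_eq_zero (integrable_bdd_mul hφ hC (hL K hK)) fun w hw => ?_)
  have hσ0 : σ ≠ 0 := by rintro rfl; simp at hσ
  rcases lt_or_gt_of_ne (mul_ne_zero hσ0 hw) with hlt | hgt
  · have h3 := h2 _ (hdb.2.2 K hK) ((starRingEnd ℂ) w) (by simpa using hlt)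
    have h4 := cauchyTransform_conj (μ := μ) (ρ := fun x => φ x * K x) ((starRingEnd ℂ) w)
    simp only [map_mul, Complex.conj_conj, Complex.conj_ofReal] at h3 h4
    rw [h3] at h4
    simpa using h4.symm
  · exact h1 K hK w hgt

theorem bddTypeQuot_halfPlane [SigmaFinite μ] (hdb : IsAlgebraicDeBranges L)
    (hL : ∀ H ∈ L, Integrable (fun x : ℝ => H x) μ) (hnd : ¬ DenseL1 μ L) {H : ℂ → ℂ}
    (hH : H ∈ L) (hH0 : H ≠ 0) (hσ : σ * σ = 1) {F G : ℂ → ℂ} (hF : Differentiable ℂ F)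
    (hG : Differentiable ℂ G) (hFi : Integrable (fun x : ℝ => F x) μ)
    (hGi : Integrable (fun x : ℝ => G x) μ)
    (hFm : ∀ z : ℂ, (‖F z‖₊ : ℝ≥0∞) ≤
      L1Majorant μ L z * ∫⁻ x : ℝ, (‖F (x : ℂ)‖₊ : ℝ≥0∞) ∂μ)
    (hGm : ∀ z : ℂ, (‖G z‖₊ : ℝ≥0∞) ≤
      L1Majorant μ L z * ∫⁻ x : ℝ, (‖G (x : ℂ)‖₊ : ℝ≥0∞) ∂μ) (hG0 : G ≠ 0) :
    BddTypeQuot {z | 0 < σ * z.im} F G := by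
  obtain ⟨φ, hφ, ⟨C, hC⟩, hann, K, hK, z₀, hz₀, hKz₀⟩ :=
    exists_annihilator_cauchyTransform_ne_zero hdb hL hnd hH hH0 hσ
  have hS := isOpen_halfPlane σ
  have hSc := isPreconnected_halfPlane σ
  set S : Set ℂ := {z | 0 < σ * z.im} with hSdef
  have hSim : ∀ z ∈ S, z.im ≠ 0 := fun z hz => im_ne_zero_of_pos_mul hz
  have hdiff : ∀ E : ℂ → ℂ, Integrable (fun x : ℝ => E x) μ →
      DifferentiableOn ℂ (cauchyTransform μ fun x => φ x * E x) S := fun E hE =>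
    (differentiableOn_cauchyTransform (integrable_bdd_mul hφ hC hE)).mono hSim
  have hFd := hdiff F hFi
  have hGd := hdiff G hGi
  have hKd := hdiff K (hL K hK)
  have hFK := fun z hz => mul_cauchyTransform_comm_of_le_majorant hdb hL hφ hC hann hF hFi hFm
    hK (hSim z hz)
  have hGK := fun z hz => mul_cauchyTransform_comm_of_le_majorant hdb hL hφ hC hann hG hGi hGm
    hK (hSim z hz)
  set cF := cauchyTransform μ fun x => φ x * F x
  set cG := cauchyTransform μ fun x => φ x * G x
  set cK := cauchyTransform μ fun x => φ x * K x
  have hKne : ¬ ∀ z ∈ S, cK z = 0 := fun h => hKz₀ (h z₀ hz₀)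
  have hFG : ∀ z ∈ S, F z * cG z = G z * cF z := by
    have hd : DifferentiableOn ℂ (fun z => F z * cG z - G z * cF z) S :=
      (hF.differentiableOn.mul hGd).sub (hG.differentiableOn.mul hFd)
    refine fun z hz => sub_eq_zero.1 ((AnalyticOnNhd.eq_zero_or_eq_zero_of_mul_eq_zero
      (hKd.analyticOnNhd hS) (hd.analyticOnNhd hS) (fun z hz => ?_) hSc).resolve_left hKne z hz)
    linear_combination cG z * hFK z hz - cF z * hGK z hz
  have hGne : ¬ ∀ z ∈ S, cG z = 0 := by
    intro h
    have h1 := (AnalyticOnNhd.eq_zero_or_eq_zero_of_mul_eq_zero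
      (hKd.analyticOnNhd hS) (hG.differentiableOn.analyticOnNhd hS)
      (fun z hz => by rw [mul_comm, hGK z hz, h z hz, mul_zero]) hSc).resolve_left hKne
    refine hG0 (AnalyticOnNhd.eq_of_eventuallyEq (z₀ := z₀) (fun z _ => hG.analyticAt z)
      (fun z _ => analyticAt_const) ?_)
    filter_upwards [hS.mem_nhds hz₀] with z hz using h1 z hz
  obtain ⟨P, hPd, hPne, ⟨A, hA⟩, A', hA'⟩ :=
    hasBoundingFactor_cauchyTransform hσ (integrable_bdd_mul hφ hC hFi)
  obtain ⟨Q, hQd, hQne, ⟨B, hB⟩, B', hB'⟩ :=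
    hasBoundingFactor_cauchyTransform hσ (integrable_bdd_mul hφ hC hGi)
  refine ⟨fun z => cF z * P z * Q z, fun z => cG z * Q z * P z, (hFd.mul hPd).mul hQd,
    (hGd.mul hQd).mul hPd, ⟨A' * B, fun z hz => ?_⟩, ⟨B' * A, fun z hz => ?_⟩, fun h => ?_,
    fun z hz => ?_⟩
  · rw [norm_mul]
    exact mul_le_mul (hA' z hz) (hB z hz) (norm_nonneg _) ((norm_nonneg _).trans (hA' z hz))
  · rw [norm_mul]
    exact mul_le_mul (hB' z hz) (hA z hz) (norm_nonneg _) ((norm_nonneg _).trans (hB' z hz))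
  · refine hGne fun z hz => ?_
    simpa [hPne z hz, hQne z hz] using h z hz
  · linear_combination (P z * Q z) * hFG z hz

end HalfPlane

/-- Pitt's theorem, third part: if `f, g` lie in the `L¹(μ)`-closure of `𝓛` and
`F, G` are entire extensions subject to the majorant bound, with `G` not identically
zero, then `F/G` is of bounded type in both half-planes. -/
theorem stmt12 (μ : Measure ℝ) [IsLocallyFiniteMeasure μ]
    (L : Submodule ℂ (ℂ → ℂ)) (hdb : IsAlgebraicDeBranges L)
    (hint : ∀ F ∈ L, (∫⁻ x : ℝ, (‖F (x : ℂ)‖₊ : ℝ≥0∞) ∂μ) < ⊤)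
    (hinj : ∀ F ∈ L, (∫⁻ x : ℝ, (‖F (x : ℂ)‖₊ : ℝ≥0∞) ∂μ) = 0 → F = 0)
    (hnd : ¬ DenseL1 μ L)
    (f g : ℝ → ℂ) (hf : MemClosL1 μ L f) (hg : MemClosL1 μ L g)
    (F G : ℂ → ℂ) (hF : Differentiable ℂ F) (hG : Differentiable ℂ G)
    (hFf : ∀ᵐ x ∂μ, f x = F (x : ℂ)) (hGg : ∀ᵐ x ∂μ, g x = G (x : ℂ))
    (hFm : ∀ z : ℂ, (‖F z‖₊ : ℝ≥0∞) ≤ L1Majorant μ L z * ∫⁻ x : ℝ, (‖f x‖₊ : ℝ≥0∞) ∂μ)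
    (hGm : ∀ z : ℂ, (‖G z‖₊ : ℝ≥0∞) ≤ L1Majorant μ L z * ∫⁻ x : ℝ, (‖g x‖₊ : ℝ≥0∞) ∂μ)
    (hGne : G ≠ 0) :
    BddTypeQuot UpperHalf F G ∧ BddTypeQuot LowerHalf F G := by
  have hL : ∀ H ∈ L, Integrable (fun x : ℝ => H x) μ := fun H hH =>
    ⟨((hdb.1 H hH).continuous.comp Complex.continuous_ofReal).aestronglyMeasurable, hint H hH⟩
  have hFi : Integrable (fun x : ℝ => F x) μ := hf.1.congr hFf
  have hGi : Integrable (fun x : ℝ => G x) μ := hg.1.congr hGg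
  have hFl : ∫⁻ x : ℝ, (‖f x‖₊ : ℝ≥0∞) ∂μ = ∫⁻ x : ℝ, (‖F (x : ℂ)‖₊ : ℝ≥0∞) ∂μ :=
    lintegral_congr_ae (hFf.mono fun x hx => by simp only [hx])
  have hGl : ∫⁻ x : ℝ, (‖g x‖₊ : ℝ≥0∞) ∂μ = ∫⁻ x : ℝ, (‖G (x : ℂ)‖₊ : ℝ≥0∞) ∂μ :=
    lintegral_congr_ae (hGg.mono fun x hx => by simp only [hx])
  rw [hFl] at hFm
  rw [hGl] at hGm
  obtain ⟨H, hH, hH0⟩ : ∃ H ∈ L, H ≠ 0 := by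
    by_contra! h
    refine hGne (funext fun z => ?_)
    have hm : L1Majorant μ L z = 0 := by
      simp only [L1Majorant, ENNReal.iSup_eq_zero]
      rintro ⟨E, hE, -⟩
      simp [h E hE]
    simpa [hm] using hGm z
  have hU : UpperHalf = {z | 0 < (1 : ℝ) * z.im} := by
    ext z
    simp [UpperHalf]
  have hD : LowerHalf = {z | 0 < (-1 : ℝ) * z.im} := by
    ext z
    simp [LowerHalf]
  rw [hU, hD]
  exact ⟨bddTypeQuot_halfPlane hdb hL hnd hH hH0 (by norm_num) hF hG hFi hGi hFm hGm hGne,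
    bddTypeQuot_halfPlane hdb hL hnd hH hH0 (by norm_num) hF hG hFi hGi hFm hGm hGne⟩
end
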